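/- arXiv:1404.4918 — 2 statements merged into one kernel-verified Lean document; each statement's English description precedes it below -/
import Mathlib

section
/- For any two nonzero rational numbers a and b, the number of places v of ℚ (primes together with the real place) at which the quadratic Hilbert symbol (a,b)_v equals -1 is finite and even; equivalently, the product over all places of (a,b)_v equals 1. -/
open Classical in
/-- The quadratic Hilbert symbol of `a, b ∈ ℚ` at the prime `p`:
it is `1` iff `a x² + b y² = 1` has a solution in `ℚ_p`, and `-1` otherwise
(and `1` by convention at non-primes). -/
noncomputable def hilbertSymQp (a b : ℚ) (p : ℕ) : ℤ :=
  if h : p.Prime then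
    (letI : Fact p.Prime := ⟨h⟩
     if ∃ x y : ℚ_[p], (a : ℚ_[p]) * x ^ 2 + (b : ℚ_[p]) * y ^ 2 = 1 then 1 else -1)
  else 1

open Classical in
/-- The quadratic Hilbert symbol of `a, b ∈ ℚ` at the real place. -/
noncomputable def hilbertSymReal (a b : ℚ) : ℤ :=
  if ∃ x y : ℝ, (a : ℝ) * x ^ 2 + (b : ℝ) * y ^ 2 = 1 then 1 else -1

/-- The conic `a x² + b y² = 1` has a point over `K`. -/
def HilbertSolvable (K : Type*) [Field K] (a b : K) : Prop :=
  ∃ x y : K, a * x ^ 2 + b * y ^ 2 = 1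

namespace HilbertSolvable

section Field

variable {K : Type*} [Field K]

theorem comm {a b : K} : HilbertSolvable K a b ↔ HilbertSolvable K b a :=
  ⟨fun ⟨x, y, h⟩ => ⟨y, x, by rw [add_comm]; exact h⟩,
    fun ⟨x, y, h⟩ => ⟨y, x, by rw [add_comm]; exact h⟩⟩

theorem sq_mul_left {a b c : K} (hc : c ≠ 0) :
    HilbertSolvable K (c ^ 2 * a) b ↔ HilbertSolvable K a b := by
  constructor
  · rintro ⟨x, y, h⟩
    exact ⟨c * x, y, by rw [← h]; ring⟩
  · rintro ⟨x, y, h⟩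
    exact ⟨c⁻¹ * x, y, by rw [← h]; field_simp⟩

theorem sq_mul_right {a b c : K} (hc : c ≠ 0) :
    HilbertSolvable K a (c ^ 2 * b) ↔ HilbertSolvable K a b := by
  rw [comm, sq_mul_left hc, comm]

/-- A nontrivial zero of `a x² + b y² - z²` yields a point of the affine conic. -/
theorem of_isotropic (h2 : (2 : K) ≠ 0) {a b x y z : K} (ha : a ≠ 0) (hb : b ≠ 0)
    (hne : x ≠ 0 ∨ y ≠ 0 ∨ z ≠ 0) (h : a * x ^ 2 + b * y ^ 2 = z ^ 2) :
    HilbertSolvable K a b := by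
  by_cases hz : z = 0
  · subst hz
    have hx : x ≠ 0 := by
      rintro rfl
      simp_all
    refine ⟨(a⁻¹ + 1) / 2, y / x * ((a⁻¹ - 1) / 2), ?_⟩
    have hb' : b * y ^ 2 = -(a * x ^ 2) := by linear_combination h
    calc a * ((a⁻¹ + 1) / 2) ^ 2 + b * (y / x * ((a⁻¹ - 1) / 2)) ^ 2
        = a * ((a⁻¹ + 1) / 2) ^ 2 + (b * y ^ 2) / x ^ 2 * ((a⁻¹ - 1) / 2) ^ 2 := by ring
      _ = 1 := by
        rw [hb']
        field_simp
        ring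
  · refine ⟨x / z, y / z, ?_⟩
    field_simp
    linear_combination h

theorem neg_mul_right_of (h2 : (2 : K) ≠ 0) {a b : K} (ha : a ≠ 0) (hb : b ≠ 0)
    (h : HilbertSolvable K a b) : HilbertSolvable K a (-(a * b)) := by
  obtain ⟨x, y, h⟩ := h
  refine of_isotropic h2 ha (neg_ne_zero.2 (mul_ne_zero ha hb)) (x := 1) (y := y) (z := a * x)
    (.inl one_ne_zero) ?_
  linear_combination (-a) * h

theorem neg_mul_right (h2 : (2 : K) ≠ 0) {a b : K} (ha : a ≠ 0) (hb : b ≠ 0) :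
    HilbertSolvable K a (-(a * b)) ↔ HilbertSolvable K a b := by
  refine ⟨fun h => ?_, neg_mul_right_of h2 ha hb⟩
  have := neg_mul_right_of h2 ha (neg_ne_zero.2 (mul_ne_zero ha hb)) h
  rwa [show -(a * -(a * b)) = a ^ 2 * b by ring, sq_mul_right ha] at this

end Field

section Padic

variable {p : ℕ} [Fact p.Prime]

theorem exists_primitive {a b : ℤ} (h : HilbertSolvable ℚ_[p] a b) :
    ∃ x y z : ℤ_[p], (x = 1 ∨ y = 1 ∨ z = 1) ∧ (a : ℤ_[p]) * x ^ 2 + b * y ^ 2 = z ^ 2 := by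
  obtain ⟨x, y, h⟩ := h
  have key : ∀ m : ℚ_[p], m ≠ 0 → ‖x‖ ≤ ‖m‖ → ‖y‖ ≤ ‖m‖ → ‖(1 : ℚ_[p])‖ ≤ ‖m‖ →
      ∃ x' y' z' : ℤ_[p], (x' : ℚ_[p]) = x / m ∧ (y' : ℚ_[p]) = y / m ∧ (z' : ℚ_[p]) = 1 / m ∧
        (a : ℤ_[p]) * x' ^ 2 + b * y' ^ 2 = z' ^ 2 := by
    intro m hm hx hy h1
    have aux : ∀ t : ℚ_[p], ‖t‖ ≤ ‖m‖ → ‖t / m‖ ≤ 1 := fun t ht => by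
      rw [norm_div]
      exact div_le_one_of_le₀ ht (norm_nonneg _)
    refine ⟨⟨x / m, aux x hx⟩, ⟨y / m, aux y hy⟩, ⟨1 / m, aux 1 h1⟩, rfl, rfl, rfl, ?_⟩
    apply Subtype.ext
    change (a : ℚ_[p]) * (x / m) ^ 2 + b * (y / m) ^ 2 = (1 / m) ^ 2
    field_simp
    exact h
  by_cases hx : ‖y‖ ≤ ‖x‖ ∧ ‖(1 : ℚ_[p])‖ ≤ ‖x‖
  · have hm : x ≠ 0 := by
      rintro rfl
      simp at hx
      linarith [hx.2]
    obtain ⟨x', y', z', hx', -, -, h'⟩ := key x hm le_rfl hx.1 hx.2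
    exact ⟨x', y', z', .inl (Subtype.ext (by rw [hx', div_self hm]; rfl)), h'⟩
  by_cases hy : ‖x‖ ≤ ‖y‖ ∧ ‖(1 : ℚ_[p])‖ ≤ ‖y‖
  · have hm : y ≠ 0 := by
      rintro rfl
      simp at hy
      linarith [hy.2]
    obtain ⟨x', y', z', -, hy', -, h'⟩ := key y hm hy.1 le_rfl hy.2
    exact ⟨x', y', z', .inr (.inl (Subtype.ext (by rw [hy', div_self hm]; rfl))), h'⟩
  · have h1 : ‖x‖ ≤ ‖(1 : ℚ_[p])‖ ∧ ‖y‖ ≤ ‖(1 : ℚ_[p])‖ := by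
      constructor <;> grind
    obtain ⟨x', y', z', -, -, hz', h'⟩ := key 1 one_ne_zero h1.1 h1.2 le_rfl
    exact ⟨x', y', z', .inr (.inr (Subtype.ext (by rw [hz', div_self one_ne_zero]; rfl))), h'⟩

end Padic

end HilbertSolvable

section LocalSquares

variable {p : ℕ} [Fact p.Prime]

theorem PadicInt.isSquare_of_norm_sub_sq_lt {t c : ℤ_[p]} (h : ‖t - c ^ 2‖ < ‖2 * c‖ ^ 2) :
    IsSquare t := by
  have := hensels_lemma (R := ℤ_[p]) (F := Polynomial.X ^ 2 - Polynomial.C t) (a := c) (by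
    simpa [norm_sub_rev, one_add_one_eq_two] using h)
  obtain ⟨z, hz, -⟩ := this
  refine ⟨z, ?_⟩
  simp at hz
  linear_combination -hz

theorem PadicInt.isSquare_of_toZMod_eq_sq (hp : p ≠ 2) {t : ℤ_[p]} {c : ZMod p} (hc : c ≠ 0)
    (h : PadicInt.toZMod t = c ^ 2) : IsSquare t := by
  obtain ⟨d, rfl⟩ := ZMod.ringHom_surjective (PadicInt.toZMod (p := p)) c
  have unit_norm : ∀ s : ℤ_[p], PadicInt.toZMod s ≠ 0 → ‖s‖ = 1 := fun s hs => by
    rw [← PadicInt.isUnit_iff]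
    by_contra hu
    exact hs (by
      rw [← RingHom.mem_ker, PadicInt.ker_toZMod]
      exact (IsLocalRing.mem_maximalIdeal _).2 hu)
  have h2 : PadicInt.toZMod (2 * d) ≠ 0 := by
    rw [map_mul, map_ofNat]
    refine mul_ne_zero ?_ hc
    intro h2
    have := (ZMod.natCast_eq_zero_iff 2 p).1 (by exact_mod_cast h2)
    exact hp ((Nat.prime_dvd_prime_iff_eq Fact.out Nat.prime_two).1 this)
  apply PadicInt.isSquare_of_norm_sub_sq_lt (c := d)
  rw [unit_norm _ h2, one_pow, ← PadicInt.mem_nonunits, ← IsLocalRing.mem_maximalIdeal,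
    ← PadicInt.ker_toZMod, RingHom.mem_ker, map_sub, map_pow, h, sub_self]

theorem PadicInt.isSquare_of_toZModPow_three_eq_one {t : ℤ_[2]}
    (h : PadicInt.toZModPow 3 t = 1) : IsSquare t := by
  apply PadicInt.isSquare_of_norm_sub_sq_lt (c := 1)
  have : t - 1 ∈ RingHom.ker (PadicInt.toZModPow (p := 2) 3) := by
    rw [RingHom.mem_ker, map_sub, h, map_one, sub_self]
  rw [PadicInt.ker_toZModPow, ← PadicInt.norm_le_pow_iff_mem_span_pow] at this
  have h2 : ‖(2 : ℤ_[2])‖ = 2⁻¹ := by exact_mod_cast PadicInt.norm_p (p := 2)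
  rw [one_pow, mul_one, h2]
  refine this.trans_lt ?_
  norm_num [zpow_neg]

end LocalSquares

/-- The quadratic character of `p`-adic units through which units pair with the prime `p`. -/
def unitChar (p : ℕ) (u : ℤ) : ℤ := if p = 2 then ZMod.χ₈ u else jacobiSym u p

/-- The Hilbert symbol of two `p`-adic units. -/
def unitSym (p : ℕ) (u v : ℤ) : ℤ :=
  if p = 2 ∧ ZMod.χ₄ u = -1 ∧ ZMod.χ₄ v = -1 then -1 else 1

theorem ZMod.intCast_eight_of_not_two_dvd {u : ℤ} (hu : ¬ (2 : ℤ) ∣ u) :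
    (u : ZMod 8) = 1 ∨ (u : ZMod 8) = 3 ∨ (u : ZMod 8) = 5 ∨ (u : ZMod 8) = 7 := by
  have : u % 8 = 1 ∨ u % 8 = 3 ∨ u % 8 = 5 ∨ u % 8 = 7 := by omega
  rcases this with h | h | h | h
  · left; exact_mod_cast (ZMod.intCast_eq_intCast_iff u 1 8).2 h
  · right; left; exact_mod_cast (ZMod.intCast_eq_intCast_iff u 3 8).2 h
  · right; right; left; exact_mod_cast (ZMod.intCast_eq_intCast_iff u 5 8).2 h
  · right; right; right; exact_mod_cast (ZMod.intCast_eq_intCast_iff u 7 8).2 h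

theorem ZMod.intCast_four_eq_cast_eight (u : ℤ) :
    (u : ZMod 4) = ZMod.castHom (by norm_num : 4 ∣ 8) (ZMod 4) (u : ZMod 8) := by simp

namespace HilbertSolvable

theorem padic_two_iff {a b : ℤ} (ha : ¬ (2 : ℤ) ∣ a) (hb : ¬ (4 : ℤ) ∣ b) :
    HilbertSolvable ℚ_[2] a b ↔
      ∃ x y z : ZMod 8, (x = 1 ∨ z = 1) ∧ (a : ZMod 8) * x ^ 2 + b * y ^ 2 = z ^ 2 := by
  have ha8 := ZMod.intCast_eight_of_not_two_dvd ha
  have haa : (a : ZMod 8) * a = 1 := by rcases ha8 with h | h | h | h <;> rw [h] <;> decide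
  have ha0 : (a : ℚ_[2]) ≠ 0 := by
    rw [Int.cast_ne_zero]; rintro rfl; simp at ha
  have hb0 : (b : ℚ_[2]) ≠ 0 := by
    rw [Int.cast_ne_zero]; rintro rfl; simp at hb
  constructor
  · intro h
    obtain ⟨x, y, z, h1, h⟩ := exists_primitive h
    have hb8 : (b : ZMod 8) ≠ 0 ∧ (b : ZMod 8) ≠ 4 := by
      constructor <;> intro h8
      · have := (ZMod.intCast_zmod_eq_zero_iff_dvd b 8).1 h8
        omega
      · have := (ZMod.intCast_eq_intCast_iff_dvd_sub b 4 8).1 (by exact_mod_cast h8)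
        omega
    replace h := congrArg (PadicInt.toZModPow (p := 2) 3) h
    simp only [map_add, map_mul, map_pow, map_intCast] at h
    change (a : ZMod 8) * _ + (b : ZMod 8) * _ = _ at h
    have h1' : PadicInt.toZModPow 3 x = 1 ∨ PadicInt.toZModPow 3 y = 1 ∨
        PadicInt.toZModPow 3 z = 1 :=
      h1.imp (by rintro rfl; simp) (Or.imp (by rintro rfl; simp) (by rintro rfl; simp))
    generalize PadicInt.toZModPow (p := 2) 3 x = x' at *
    generalize PadicInt.toZModPow (p := 2) 3 y = y' at *
    generalize PadicInt.toZModPow (p := 2) 3 z = z' at *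
    generalize (b : ZMod 8) = b' at *
    generalize (a : ZMod 8) = a' at *
    clear h1 ha0 hb0 ha hb haa x y z
    change ZMod 8 at x' y' z'
    revert a' b' x' y' z'
    decide +kernel
  · rintro ⟨x, y, z, h1, h⟩
    have hs : Function.Surjective (PadicInt.toZModPow (p := 2) 3) := ZMod.ringHom_surjective _
    obtain ⟨x, rfl⟩ := hs x
    obtain ⟨y, rfl⟩ := hs y
    obtain ⟨z, rfl⟩ := hs z
    rcases h1 with h1 | h1
    · obtain ⟨w, hw⟩ := PadicInt.isSquare_of_toZModPow_three_eq_one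
        (t := a * (z ^ 2 - b * y ^ 2)) (by
          simp only [map_sub, map_mul, map_pow, map_intCast]
          change (a : ZMod 8) * (_ - (b : ZMod 8) * _) = 1
          rw [h1] at h
          linear_combination haa - (a : ZMod 8) * h)
      have hw' : (a : ℚ_[2]) * (z ^ 2 - b * y ^ 2) = w * w := by
        exact_mod_cast congrArg ((↑) : ℤ_[2] → ℚ_[2]) hw
      by_cases hyz : y = 0 ∧ z = 0
      · exfalso
        obtain ⟨rfl, rfl⟩ := hyz
        rw [h1, map_zero] at h
        rcases ha8 with h' | h' | h' | h' <;> rw [h'] at h <;> revert h <;>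
          generalize (b : ZMod 8) = b' <;> revert b' <;> decide
      · refine of_isotropic two_ne_zero ha0 hb0 (x := w / a) (y := y) (z := z) ?_ ?_
        · right
          by_contra! hyz'
          exact hyz ⟨Subtype.ext hyz'.1, Subtype.ext hyz'.2⟩
        · field_simp
          linear_combination -hw'
    · obtain ⟨w, hw⟩ := PadicInt.isSquare_of_toZModPow_three_eq_one
        (t := a * x ^ 2 + b * y ^ 2) (by
          simp only [map_add, map_mul, map_pow, map_intCast]
          change (a : ZMod 8) * _ + (b : ZMod 8) * _ = 1
          rw [h, h1, one_pow])
      have hw' : (a : ℚ_[2]) * x ^ 2 + b * y ^ 2 = w * w := by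
        exact_mod_cast congrArg ((↑) : ℤ_[2] → ℚ_[2]) hw
      by_cases hxy : x = 0 ∧ y = 0
      · exfalso
        obtain ⟨rfl, rfl⟩ := hxy
        rw [h1, map_zero] at h
        generalize (a : ZMod 8) = a' at h
        generalize (b : ZMod 8) = b' at h
        revert a' b'
        decide
      · refine of_isotropic two_ne_zero ha0 hb0 (x := x) (y := y) (z := w) ?_ ?_
        · by_contra! hxy'
          exact hxy ⟨Subtype.ext hxy'.1, Subtype.ext hxy'.2.1⟩
        · linear_combination hw'

theorem padic_two_unit_unit {u v : ℤ} (hu : ¬ (2 : ℤ) ∣ u) (hv : ¬ (2 : ℤ) ∣ v) :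
    HilbertSolvable ℚ_[2] u v ↔ unitSym 2 u v = 1 := by
  rw [padic_two_iff hu (by omega), unitSym, ZMod.intCast_four_eq_cast_eight,
    ZMod.intCast_four_eq_cast_eight]
  rcases ZMod.intCast_eight_of_not_two_dvd hu with h | h | h | h <;>
  rcases ZMod.intCast_eight_of_not_two_dvd hv with h' | h' | h' | h' <;> rw [h, h'] <;> decide +kernel

theorem padic_two_unit_prime_mul {u v : ℤ} (hu : ¬ (2 : ℤ) ∣ u) (hv : ¬ (2 : ℤ) ∣ v) :
    HilbertSolvable ℚ_[2] u ((2 * v : ℤ) : ℚ_[2]) ↔ unitSym 2 u v * unitChar 2 u = 1 := by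
  rw [padic_two_iff hu (by omega), unitSym, unitChar, ZMod.intCast_four_eq_cast_eight,
    ZMod.intCast_four_eq_cast_eight]
  push_cast
  rcases ZMod.intCast_eight_of_not_two_dvd hu with h | h | h | h <;>
  rcases ZMod.intCast_eight_of_not_two_dvd hv with h' | h' | h' | h' <;> rw [h, h'] <;> decide +kernel

section Odd

variable {p : ℕ} [Fact p.Prime]

theorem padic_odd_unit_unit (hp : p ≠ 2) {u v : ℤ} (hu : ¬ (p : ℤ) ∣ u) (hv : ¬ (p : ℤ) ∣ v) :
    HilbertSolvable ℚ_[p] u v := by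
  have hu' : (u : ZMod p) ≠ 0 := fun h => hu ((ZMod.intCast_zmod_eq_zero_iff_dvd u p).1 h)
  have hv' : (v : ZMod p) ≠ 0 := fun h => hv ((ZMod.intCast_zmod_eq_zero_iff_dvd v p).1 h)
  have hu0 : (u : ℚ_[p]) ≠ 0 := by rw [Int.cast_ne_zero]; rintro rfl; simp at hu
  have hv0 : (v : ℚ_[p]) ≠ 0 := by rw [Int.cast_ne_zero]; rintro rfl; simp at hv
  -- It suffices to lift a solution modulo `p` whose first coordinate is a unit.
  have lift : ∀ a b : ℤ, (a : ZMod p) ≠ 0 → (a : ℚ_[p]) ≠ 0 → (b : ℚ_[p]) ≠ 0 → ∀ x y : ZMod p,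
      x ≠ 0 → (a : ZMod p) * x ^ 2 + b * y ^ 2 = 1 → HilbertSolvable ℚ_[p] a b := by
    intro a b ha ha0 hb0 x y hx h
    obtain ⟨y, rfl⟩ := ZMod.ringHom_surjective (PadicInt.toZMod (p := p)) y
    obtain ⟨w, hw⟩ := PadicInt.isSquare_of_toZMod_eq_sq hp (t := a * (1 - b * y ^ 2))
      (mul_ne_zero ha hx) (by
        simp only [map_sub, map_mul, map_pow, map_intCast, map_one]
        linear_combination -(a : ZMod p) * h)
    have hw' : (a : ℚ_[p]) * (1 - b * y ^ 2) = w * w := by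
      exact_mod_cast congrArg ((↑) : ℤ_[p] → ℚ_[p]) hw
    refine ⟨w / a, y, ?_⟩
    field_simp
    linear_combination -hw'
  obtain ⟨x, y, h⟩ : ∃ x y : ZMod p, (u : ZMod p) * x ^ 2 + v * y ^ 2 = 1 := by
    obtain ⟨x, y, h⟩ := FiniteField.exists_root_sum_quadratic
      (f := Polynomial.C (u : ZMod p) * Polynomial.X ^ 2)
      (g := Polynomial.C (v : ZMod p) * Polynomial.X ^ 2 + Polynomial.C 0 * Polynomial.X +
        Polynomial.C (-1)) (Polynomial.degree_C_mul_X_pow 2 hu')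
      (Polynomial.degree_quadratic hv')
      (by rw [ZMod.card]; exact (Fact.out : p.Prime).eq_two_or_odd.resolve_left hp)
    refine ⟨x, y, ?_⟩
    simp at h
    linear_combination h
  by_cases hx : x = 0
  · subst hx
    have hy : y ≠ 0 := by rintro rfl; simp at h
    exact comm.1 (lift v u hv' hv0 hu0 y 0 hy (by linear_combination h))
  · exact lift u v hu' hu0 hv0 x y hx h

theorem padic_odd_unit_prime_mul (hp : p ≠ 2) {u v : ℤ} (hu : ¬ (p : ℤ) ∣ u)
    (hv : ¬ (p : ℤ) ∣ v) :
    HilbertSolvable ℚ_[p] u ((p * v : ℤ) : ℚ_[p]) ↔ jacobiSym u p = 1 := by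
  have hu' : (u : ZMod p) ≠ 0 := fun h => hu ((ZMod.intCast_zmod_eq_zero_iff_dvd u p).1 h)
  have hv' : (v : ZMod p) ≠ 0 := fun h => hv ((ZMod.intCast_zmod_eq_zero_iff_dvd v p).1 h)
  have hu0 : (u : ℚ_[p]) ≠ 0 := by rw [Int.cast_ne_zero]; rintro rfl; simp at hu
  have hpp : Prime (p : ℤ_[p]) := PadicInt.prime_p
  have toZMod_eq_zero : ∀ t : ℤ_[p], PadicInt.toZMod t = 0 ↔ (p : ℤ_[p]) ∣ t := fun t => by
    rw [← RingHom.mem_ker, PadicInt.ker_toZMod, PadicInt.maximalIdeal_eq_span_p,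
      Ideal.mem_span_singleton]
  rw [← jacobiSym.legendreSym.to_jacobiSym, legendreSym.eq_one_iff p hu']
  constructor
  · intro h
    obtain ⟨x, y, z, h1, h⟩ := exists_primitive h
    have h' := congrArg (PadicInt.toZMod (p := p)) h
    simp only [map_add, map_mul, map_pow, map_intCast, Int.cast_mul, Int.cast_natCast,
      map_natCast, CharP.cast_eq_zero, zero_mul, add_zero] at h'
    by_cases hx : PadicInt.toZMod x = 0
    · exfalso
      have hz : PadicInt.toZMod z = 0 := by
        rw [hx] at h'
        exact pow_eq_zero_iff two_ne_zero |>.1 (by rw [← h']; ring)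
      obtain ⟨x', rfl⟩ := (toZMod_eq_zero x).1 hx
      obtain ⟨z', rfl⟩ := (toZMod_eq_zero z).1 hz
      push_cast at h
      have hy : (p : ℤ_[p]) ∣ v * y ^ 2 := by
        refine ⟨z' ^ 2 - u * x' ^ 2, mul_left_cancel₀ hpp.ne_zero ?_⟩
        linear_combination h
      have hvp : ¬ (p : ℤ_[p]) ∣ v := by
        rw [← toZMod_eq_zero, map_intCast]
        exact hv'
      have hy := hpp.dvd_of_dvd_pow ((hpp.dvd_or_dvd hy).resolve_left hvp)
      rcases h1 with h1 | rfl | h1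
      · exact hpp.not_isUnit (.of_mul_eq_one _ h1)
      · exact hpp.not_isUnit (isUnit_of_dvd_one hy)
      · exact hpp.not_isUnit (.of_mul_eq_one _ h1)
    · refine ⟨PadicInt.toZMod z / PadicInt.toZMod x, ?_⟩
      field_simp
      exact h'
  · rintro ⟨c, hc⟩
    obtain ⟨w, hw⟩ := PadicInt.isSquare_of_toZMod_eq_sq hp (t := (u : ℤ_[p])) (c := c)
      (by rintro rfl; exact hu' (by simpa using hc)) (by rw [map_intCast, hc, sq])
    have hw' : (u : ℚ_[p]) = w * w := by exact_mod_cast congrArg ((↑) : ℤ_[p] → ℚ_[p]) hw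
    refine ⟨w / u, 0, ?_⟩
    field_simp
    linear_combination -hw'

end Odd

section Prime

variable {p : ℕ} [Fact p.Prime]

theorem padic_unit_unit {u v : ℤ} (hu : ¬ (p : ℤ) ∣ u) (hv : ¬ (p : ℤ) ∣ v) :
    HilbertSolvable ℚ_[p] u v ↔ unitSym p u v = 1 := by
  obtain rfl | hp := eq_or_ne p 2
  · exact padic_two_unit_unit hu hv
  · simp [padic_odd_unit_unit hp hu hv, unitSym, hp]

theorem padic_unit_prime_mul {u v : ℤ} (hu : ¬ (p : ℤ) ∣ u) (hv : ¬ (p : ℤ) ∣ v) :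
    HilbertSolvable ℚ_[p] u ((p * v : ℤ) : ℚ_[p]) ↔ unitSym p u v * unitChar p u = 1 := by
  obtain rfl | hp := eq_or_ne p 2
  · exact padic_two_unit_prime_mul hu hv
  · rw [padic_odd_unit_prime_mul hp hu hv]
    simp [unitSym, unitChar, hp]

end Prime

end HilbertSolvable

/-- The prime-to-`p` part of a nonzero integer, with its sign. -/
def unitPart (p : ℕ) (a : ℤ) : ℤ := a / p ^ padicValInt p a

/-- The explicit formula for the Hilbert symbol at the prime `p` of two nonzero integers. -/
def localSym (p : ℕ) (a b : ℤ) : ℤ :=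
  unitSym p (unitPart p a) (unitPart p b) * unitChar p (unitPart p b) ^ padicValInt p a *
    unitChar p (unitPart p a) ^ padicValInt p b *
    unitChar p (-1) ^ (padicValInt p a * padicValInt p b)

theorem unitChar_mul (p : ℕ) (u v : ℤ) : unitChar p (u * v) = unitChar p u * unitChar p v := by
  unfold unitChar
  split_ifs
  · push_cast; exact map_mul _ _ _
  · exact jacobiSym.mul_left u v p

theorem unitSym_comm (p : ℕ) (u v : ℤ) : unitSym p u v = unitSym p v u := by
  simp only [unitSym, and_comm]

theorem unitSym_eq_one_or (p : ℕ) (u v : ℤ) : unitSym p u v = 1 ∨ unitSym p u v = -1 := by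
  unfold unitSym
  split_ifs <;> simp

theorem unitSym_one_right (p : ℕ) (u : ℤ) : unitSym p u 1 = 1 := by
  have : (1 : ℤ) ≠ -1 := by decide
  simp [unitSym, this]

theorem ZMod.χ₄_intCast_eq_one_or {u : ℤ} (hu : ¬ (2 : ℤ) ∣ u) : χ₄ u = 1 ∨ χ₄ u = -1 := by
  have : u % 4 = 1 ∨ u % 4 = 3 := by omega
  exact this.imp χ₄_int_one_mod_four χ₄_int_three_mod_four

theorem pow_mul_unitPart (p : ℕ) (a : ℤ) : (p : ℤ) ^ padicValInt p a * unitPart p a = a :=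
  Int.mul_ediv_cancel' (padicValInt_dvd a)

theorem unitPart_of_not_dvd {p : ℕ} {a : ℤ} (ha : ¬ (p : ℤ) ∣ a) : unitPart p a = a := by
  simp [unitPart, padicValInt.eq_zero_of_not_dvd ha]

theorem localSym_of_not_dvd {p : ℕ} {a b : ℤ} (ha : ¬ (p : ℤ) ∣ a) (hb : ¬ (p : ℤ) ∣ b) :
    localSym p a b = unitSym p a b := by
  simp [localSym, unitPart_of_not_dvd ha, unitPart_of_not_dvd hb,
    padicValInt.eq_zero_of_not_dvd ha, padicValInt.eq_zero_of_not_dvd hb]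

theorem localSym_of_not_dvd_of_ne_two {p : ℕ} {a b : ℤ} (hp : p ≠ 2) (ha : ¬ (p : ℤ) ∣ a)
    (hb : ¬ (p : ℤ) ∣ b) : localSym p a b = 1 := by
  rw [localSym_of_not_dvd ha hb]
  simp [unitSym, hp]

theorem localSym_comm (p : ℕ) (a b : ℤ) : localSym p a b = localSym p b a := by
  unfold localSym
  rw [unitSym_comm, mul_comm (padicValInt p a)]
  ring

theorem Nat.Prime.not_intCast_dvd_neg_one {p : ℕ} (hp : p.Prime) : ¬ (p : ℤ) ∣ -1 := by
  rw [dvd_neg]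
  exact (Nat.prime_iff_prime_int.1 hp).not_dvd_one

section Prime

variable {p : ℕ} [Fact p.Prime]

theorem unitChar_eq_one_or {u : ℤ} (hu : ¬ (p : ℤ) ∣ u) :
    unitChar p u = 1 ∨ unitChar p u = -1 := by
  unfold unitChar
  split_ifs with hp
  · subst hp
    rcases ZMod.intCast_eight_of_not_two_dvd hu with h | h | h | h <;> rw [h] <;> decide
  · apply jacobiSym.eq_one_or_neg_one
    rw [Int.gcd_comm]
    exact (Int.isCoprime_iff_gcd_eq_one.1
      ((Nat.prime_iff_prime_int.1 Fact.out).coprime_iff_not_dvd.2 hu))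

theorem unitSym_mul_left {u u' v : ℤ} (hu : ¬ (p : ℤ) ∣ u) (hu' : ¬ (p : ℤ) ∣ u') :
    unitSym p (u * u') v = unitSym p u v * unitSym p u' v := by
  by_cases hp : p = 2
  · subst hp
    unfold unitSym
    rw [Int.cast_mul, map_mul]
    have : (1 : ℤ) ≠ -1 := by decide
    rcases ZMod.χ₄_intCast_eq_one_or hu with h | h <;>
    rcases ZMod.χ₄_intCast_eq_one_or hu' with h' | h' <;>
    by_cases hv : ZMod.χ₄ v = -1 <;> simp only [h, h', hv, this] <;> simp
  · simp [unitSym, hp]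

theorem unitSym_neg_self {u : ℤ} (hu : ¬ (p : ℤ) ∣ u) : unitSym p u (-u) = 1 := by
  by_cases hp : p = 2
  · subst hp
    unfold unitSym
    have : (1 : ℤ) ≠ -1 := by decide
    rw [← neg_one_mul u, Int.cast_mul, map_mul, show ZMod.χ₄ ((-1 : ℤ) : ZMod 4) = -1 by decide]
    rcases ZMod.χ₄_intCast_eq_one_or hu with h | h <;> simp [h, this]
  · simp [unitSym, hp]

theorem unitPart_eq_iff {a u : ℤ} : unitPart p a = u ↔ (p : ℤ) ^ padicValInt p a * u = a := by
  have hp : (p : ℤ) ^ padicValInt p a ≠ 0 :=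
    pow_ne_zero _ (Nat.cast_ne_zero.2 (Fact.out : p.Prime).ne_zero)
  constructor
  · rintro rfl
    exact pow_mul_unitPart p a
  · intro h
    exact mul_left_cancel₀ hp ((pow_mul_unitPart p a).trans h.symm)

theorem not_dvd_unitPart {a : ℤ} (ha : a ≠ 0) : ¬ (p : ℤ) ∣ unitPart p a := by
  rintro ⟨c, hc⟩
  have h : (p : ℤ) ^ (padicValInt p a + 1) ∣ a :=
    ⟨c, by rw [pow_succ, mul_assoc, ← hc, pow_mul_unitPart]⟩
  rcases (padicValInt_dvd_iff (p := p) _ a).1 h with h | h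
  · exact ha h
  · omega

theorem unitPart_mul {a b : ℤ} (ha : a ≠ 0) (hb : b ≠ 0) :
    unitPart p (a * b) = unitPart p a * unitPart p b := by
  rw [unitPart_eq_iff, padicValInt.mul ha hb]
  calc _ = ((p : ℤ) ^ padicValInt p a * unitPart p a) *
        ((p : ℤ) ^ padicValInt p b * unitPart p b) := by ring
    _ = a * b := by rw [pow_mul_unitPart, pow_mul_unitPart]

theorem unitPart_self : unitPart p p = 1 := by
  rw [unitPart_eq_iff, padicValInt_self, pow_one, mul_one]

theorem localSym_mul_left {a a' b : ℤ} (ha : a ≠ 0) (ha' : a' ≠ 0) :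
    localSym p (a * a') b = localSym p a b * localSym p a' b := by
  unfold localSym
  rw [unitPart_mul ha ha', padicValInt.mul ha ha', unitChar_mul,
    unitSym_mul_left (not_dvd_unitPart ha) (not_dvd_unitPart ha')]
  ring

theorem localSym_eq_one_or {a b : ℤ} (ha : a ≠ 0) (hb : b ≠ 0) :
    localSym p a b = 1 ∨ localSym p a b = -1 := by
  have h1 : ¬ (p : ℤ) ∣ -1 := (Fact.out : p.Prime).not_intCast_dvd_neg_one
  rw [← Int.isUnit_iff]
  refine ((IsUnit.mul ?_ (.pow _ ?_)).mul (.pow _ ?_)).mul (.pow _ ?_) <;> rw [Int.isUnit_iff]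
  · exact unitSym_eq_one_or _ _ _
  · exact unitChar_eq_one_or (not_dvd_unitPart hb)
  · exact unitChar_eq_one_or (not_dvd_unitPart ha)
  · exact unitChar_eq_one_or h1

theorem localSym_self_right {a : ℤ} (ha : ¬ (p : ℤ) ∣ a) : localSym p a p = unitChar p a := by
  simp [localSym, unitPart_of_not_dvd ha, unitPart_self, padicValInt.eq_zero_of_not_dvd ha,
    unitSym_one_right]

theorem localSym_neg_self {a : ℤ} (ha : a ≠ 0) : localSym p a (-a) = 1 := by
  have h1 : ¬ (p : ℤ) ∣ -1 := (Fact.out : p.Prime).not_intCast_dvd_neg_one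
  have hu := not_dvd_unitPart (p := p) ha
  have hneg : unitPart p (-a) = -unitPart p a := by
    rw [← neg_one_mul, unitPart_mul (by decide) ha, unitPart_of_not_dvd h1, neg_one_mul]
  have hval : padicValInt p (-a) = padicValInt p a := by simp [padicValInt]
  rw [localSym, hneg, hval, unitSym_neg_self hu, ← neg_one_mul (unitPart p a), unitChar_mul]
  generalize padicValInt p a = n
  have hs : ∀ k : ℕ, Even k → unitChar p (-1) ^ k = 1 := fun k hk => by
    rcases unitChar_eq_one_or h1 with h | h <;> simp [h, hk]
  have hs' : ∀ k : ℕ, Even k → unitChar p (unitPart p a) ^ k = 1 := fun k hk => by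
    rcases unitChar_eq_one_or hu with h | h <;> simp [h, hk]
  calc _ = unitChar p (-1) ^ (n * (n + 1)) * unitChar p (unitPart p a) ^ (2 * n) := by ring
    _ = 1 := by rw [hs _ (Nat.even_mul_succ_self n), hs' _ (even_two_mul n), one_mul]

theorem HilbertSolvable.padic_iff {a b : ℤ} (ha : a ≠ 0) (hb : b ≠ 0) :
    HilbertSolvable ℚ_[p] a b ↔ localSym p a b = 1 := by
  have hp0 : (p : ℚ_[p]) ≠ 0 := Nat.cast_ne_zero.2 (Fact.out : p.Prime).ne_zero
  have hua := not_dvd_unitPart (p := p) ha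
  have hub := not_dvd_unitPart (p := p) hb
  have ea := pow_mul_unitPart p a
  have eb := pow_mul_unitPart p b
  unfold localSym
  generalize unitPart p a = u at *
  generalize unitPart p b = v at *
  generalize padicValInt p a = m at *
  generalize padicValInt p b = n at *
  subst ea eb
  have even_left : ∀ (k : ℕ) (c d : ℚ_[p]),
      HilbertSolvable ℚ_[p] ((p : ℚ_[p]) ^ (k + k) * c) d ↔ HilbertSolvable ℚ_[p] c d :=
    fun k c d => by rw [← two_mul, mul_comm 2 k, pow_mul, sq_mul_left (pow_ne_zero _ hp0)]
  have odd_left : ∀ (k : ℕ) (c d : ℚ_[p]),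
      HilbertSolvable ℚ_[p] ((p : ℚ_[p]) ^ (2 * k + 1) * c) d ↔
      HilbertSolvable ℚ_[p] (p * c) d := fun k c d => by
    rw [pow_succ, mul_comm 2 k, pow_mul, mul_assoc, sq_mul_left (pow_ne_zero _ hp0)]
  have even_right : ∀ (k : ℕ) (c d : ℚ_[p]),
      HilbertSolvable ℚ_[p] d ((p : ℚ_[p]) ^ (k + k) * c) ↔ HilbertSolvable ℚ_[p] d c :=
    fun k c d => by rw [comm, even_left, comm]
  have odd_right : ∀ (k : ℕ) (c d : ℚ_[p]),
      HilbertSolvable ℚ_[p] d ((p : ℚ_[p]) ^ (2 * k + 1) * c) ↔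
      HilbertSolvable ℚ_[p] d (p * c) := fun k c d => by rw [comm, odd_left, comm]
  have h1 : ¬ (p : ℤ) ∣ -1 := (Fact.out : p.Prime).not_intCast_dvd_neg_one
  have even_pow : ∀ w : ℤ, ¬ (p : ℤ) ∣ w → ∀ k, Even k → unitChar p w ^ k = 1 :=
    fun w hw k hk => by rcases unitChar_eq_one_or hw with h | h <;> simp [h, hk]
  have odd_pow : ∀ w : ℤ, ¬ (p : ℤ) ∣ w → ∀ k, Odd k → unitChar p w ^ k = unitChar p w :=
    fun w hw k hk => by rcases unitChar_eq_one_or hw with h | h <;> simp [h, hk]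
  push_cast
  rcases m.even_or_odd with hm | hm <;> rcases n.even_or_odd with hn | hn
  · rw [even_pow v hub m hm, even_pow u hua n hn, even_pow _ h1 _ (hm.mul_right n)]
    obtain ⟨k, rfl⟩ := hm
    obtain ⟨l, rfl⟩ := hn
    rw [even_left, even_right, padic_unit_unit hua hub, mul_one, mul_one, mul_one]
  · rw [even_pow v hub m hm, odd_pow u hua n hn, even_pow _ h1 _ (hm.mul_right n)]
    obtain ⟨k, rfl⟩ := hm
    obtain ⟨l, rfl⟩ := hn
    have := padic_unit_prime_mul hua hub
    push_cast at this
    rw [even_left, odd_right, this, mul_one, mul_one]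
  · rw [odd_pow v hub m hm, even_pow u hua n hn, even_pow _ h1 _ (hn.mul_left m)]
    obtain ⟨k, rfl⟩ := hm
    obtain ⟨l, rfl⟩ := hn
    have := padic_unit_prime_mul hub hua
    push_cast at this
    rw [odd_left, even_right, comm, this, mul_one, mul_one, unitSym_comm]
  · rw [odd_pow v hub m hm, odd_pow u hua n hn, odd_pow _ h1 _ (hm.mul hn)]
    obtain ⟨k, rfl⟩ := hm
    obtain ⟨l, rfl⟩ := hn
    have hu0 : (u : ℚ_[p]) ≠ 0 := by rw [Int.cast_ne_zero]; rintro rfl; simp at hua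
    have hv0 : (v : ℚ_[p]) ≠ 0 := by rw [Int.cast_ne_zero]; rintro rfl; simp at hub
    have huv : ¬ (p : ℤ) ∣ -(u * v) := by
      rw [dvd_neg, (Nat.prime_iff_prime_int.1 (Fact.out : p.Prime)).dvd_mul]
      tauto
    have hnu : ¬ (p : ℤ) ∣ -u := by rwa [dvd_neg]
    have := padic_unit_prime_mul huv hua
    push_cast at this
    rw [odd_left, odd_right, ← neg_mul_right two_ne_zero (mul_ne_zero hp0 hu0)
      (mul_ne_zero hp0 hv0), show -((p : ℚ_[p]) * u * (p * v)) = (p : ℚ_[p]) ^ 2 * -(u * v) by ring,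
      sq_mul_right hp0, comm, this, ← neg_mul, unitSym_mul_left hnu hub, unitSym_comm p (-u),
      unitSym_neg_self hua, unitSym_comm p v, ← neg_one_mul u, unitChar_mul, unitChar_mul]
    rw [one_mul, show ∀ a b c d : ℤ, a * (b * c * d) = a * d * c * b by intros; ring]

end Prime

/-- The explicit formula for the Hilbert symbol at the real place. -/
def realSym (a b : ℤ) : ℤ := if a < 0 ∧ b < 0 then -1 else 1

theorem realSym_comm (a b : ℤ) : realSym a b = realSym b a := by
  simp only [realSym, and_comm]

theorem realSym_mul_left {a a' b : ℤ} (ha : a ≠ 0) (ha' : a' ≠ 0) :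
    realSym (a * a') b = realSym a b * realSym a' b := by
  unfold realSym
  rcases ha.lt_or_gt with h | h <;> rcases ha'.lt_or_gt with h' | h' <;>
    by_cases hb : b < 0 <;>
    simp [h, h', hb, h.not_gt, h'.not_gt, mul_neg_iff]

theorem realSym_natCast_left (a : ℕ) (b : ℤ) : realSym a b = 1 := by
  simp [realSym]

theorem HilbertSolvable.real_iff {a b : ℤ} (ha : a ≠ 0) (hb : b ≠ 0) :
    HilbertSolvable ℝ a b ↔ realSym a b = 1 := by
  have of_pos : ∀ c d : ℝ, 0 < c → HilbertSolvable ℝ c d := fun c d hc =>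
    ⟨√c⁻¹, 0, by rw [Real.sq_sqrt (inv_nonneg.2 hc.le)]; field_simp; ring⟩
  unfold realSym
  split_ifs with h
  · refine iff_of_false ?_ (by decide)
    rintro ⟨x, y, hxy⟩
    have ha : (a : ℝ) < 0 := Int.cast_lt_zero.2 h.1
    have hb : (b : ℝ) < 0 := Int.cast_lt_zero.2 h.2
    nlinarith [mul_nonneg (neg_nonneg.2 ha.le) (sq_nonneg x),
      mul_nonneg (neg_nonneg.2 hb.le) (sq_nonneg y)]
  · refine iff_of_true ?_ rfl
    rcases ha.lt_or_gt with ha | ha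
    · exact comm.1 (of_pos b a (Int.cast_pos.2 (by omega)))
    · exact of_pos a b (Int.cast_pos.2 ha)

/-- The product of the explicit local symbols over the real place and the primes below `N`. -/
def globalSym (N : ℕ) (a b : ℤ) : ℤ := realSym a b * ∏ p ∈ N.primesBelow, localSym p a b

theorem globalSym_comm (N : ℕ) (a b : ℤ) : globalSym N a b = globalSym N b a := by
  simp only [globalSym, realSym_comm a b, localSym_comm _ a b]

theorem globalSym_mul_left (N : ℕ) {a a' : ℤ} (b : ℤ) (ha : a ≠ 0) (ha' : a' ≠ 0) :
    globalSym N (a * a') b = globalSym N a b * globalSym N a' b := by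
  unfold globalSym
  rw [realSym_mul_left ha ha', Finset.prod_congr rfl fun p hp => by
    have : Fact p.Prime := ⟨(Nat.mem_primesBelow.1 hp).2⟩
    exact localSym_mul_left ha ha', Finset.prod_mul_distrib]
  ring

theorem Nat.Prime.not_intCast_dvd_of_ne {p q : ℕ} (hp : p.Prime) (hq : q.Prime) (h : p ≠ q) :
    ¬ (p : ℤ) ∣ q := by
  rw [Int.natCast_dvd_natCast, Nat.prime_dvd_prime_iff_eq hp hq]
  exact h

theorem globalSym_eq_of_subset {N : ℕ} {a b : ℤ} (s : Finset ℕ) (hs : s ⊆ N.primesBelow)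
    (h2 : 2 ∈ s) (h : ∀ p : ℕ, p.Prime → p ∉ s → ¬ (p : ℤ) ∣ a ∧ ¬ (p : ℤ) ∣ b) :
    globalSym N a b = realSym a b * ∏ p ∈ s, localSym p a b := by
  rw [globalSym, ← Finset.prod_subset hs]
  intro p hp hps
  have hp := (Nat.mem_primesBelow.1 hp).2
  have : Fact p.Prime := ⟨hp⟩
  exact localSym_of_not_dvd_of_ne_two (by rintro rfl; exact hps h2) (h p hp hps).1 (h p hp hps).2

theorem Nat.two_mem_primesBelow {N : ℕ} (hN : 2 < N) : 2 ∈ N.primesBelow :=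
  Nat.mem_primesBelow.2 ⟨hN, Nat.prime_two⟩

theorem globalSym_neg_one_neg_one {N : ℕ} (hN : 2 < N) : globalSym N (-1) (-1) = 1 := by
  rw [globalSym_eq_of_subset {2}
    (Finset.singleton_subset_iff.2 (Nat.two_mem_primesBelow hN)) (by simp)
    fun p hp _ => ⟨hp.not_intCast_dvd_neg_one, hp.not_intCast_dvd_neg_one⟩,
    Finset.prod_singleton, localSym_of_not_dvd (by decide) (by decide)]
  decide

theorem globalSym_neg_one_prime {N q : ℕ} (hN : 2 < N) (hq : q ∈ N.primesBelow) :
    globalSym N (-1) q = 1 := by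
  have hqp := (Nat.mem_primesBelow.1 hq).2
  have : Fact q.Prime := ⟨hqp⟩
  rw [globalSym_eq_of_subset {2, q} (Finset.insert_subset (Nat.two_mem_primesBelow hN)
    (Finset.singleton_subset_iff.2 hq)) (by simp)
    fun p hp hps => ⟨hp.not_intCast_dvd_neg_one, hp.not_intCast_dvd_of_ne hqp (by grind)⟩,
    realSym_comm, realSym_natCast_left, one_mul]
  obtain rfl | hq2 := eq_or_ne q 2
  · rw [Finset.pair_eq_singleton, Finset.prod_singleton,
      localSym_self_right hqp.not_intCast_dvd_neg_one]
    decide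
  · have h2q : ¬ (2 : ℤ) ∣ q := Nat.prime_two.not_intCast_dvd_of_ne hqp hq2.symm
    rw [Finset.prod_pair hq2.symm, localSym_self_right hqp.not_intCast_dvd_neg_one,
      localSym_of_not_dvd (by decide) h2q, unitChar, if_neg hq2,
      jacobiSym.at_neg_one (hqp.odd_of_ne_two hq2), unitSym]
    have h := ZMod.χ₄_intCast_eq_one_or h2q
    rw [Int.cast_natCast] at h ⊢
    have : ZMod.χ₄ ((-1 : ℤ) : ZMod 4) = -1 := by decide
    rcases h with h | h <;> rw [h, this] <;> decide

theorem globalSym_two_prime {N q : ℕ} (hN : 2 < N) (hq : q ∈ N.primesBelow) (hq2 : q ≠ 2) :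
    globalSym N (2 : ℕ) q = 1 := by
  have hqp := (Nat.mem_primesBelow.1 hq).2
  have : Fact q.Prime := ⟨hqp⟩
  have h2q := Nat.prime_two.not_intCast_dvd_of_ne hqp hq2.symm
  rw [globalSym_eq_of_subset {2, q} (Finset.insert_subset (Nat.two_mem_primesBelow hN)
    (Finset.singleton_subset_iff.2 hq)) (by simp)
    fun p hp hps => ⟨hp.not_intCast_dvd_of_ne Nat.prime_two (by grind),
      hp.not_intCast_dvd_of_ne hqp (by grind)⟩,
    realSym_natCast_left, one_mul, Finset.prod_pair hq2.symm, localSym_comm 2,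
    localSym_self_right h2q, localSym_self_right (hqp.not_intCast_dvd_of_ne Nat.prime_two hq2),
    unitChar, if_pos rfl, unitChar, if_neg hq2, Nat.cast_ofNat,
    jacobiSym.at_two (hqp.odd_of_ne_two hq2)]
  have h := unitChar_eq_one_or h2q
  rw [unitChar, if_pos rfl] at h
  rw [Int.cast_natCast] at h ⊢
  rcases h with h | h <;> rw [h] <;> rfl

theorem globalSym_odd_prime_odd_prime {N l q : ℕ} (hN : 2 < N) (hl : l ∈ N.primesBelow)
    (hq : q ∈ N.primesBelow) (hl2 : l ≠ 2) (hq2 : q ≠ 2) (hlq : l ≠ q) :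
    globalSym N l q = 1 := by
  have hlp := (Nat.mem_primesBelow.1 hl).2
  have hqp := (Nat.mem_primesBelow.1 hq).2
  have : Fact q.Prime := ⟨hqp⟩
  have : Fact l.Prime := ⟨hlp⟩
  have h2q := Nat.prime_two.not_intCast_dvd_of_ne hqp hq2.symm
  have h2l := Nat.prime_two.not_intCast_dvd_of_ne hlp hl2.symm
  have hJ := unitChar_eq_one_or (hlp.not_intCast_dvd_of_ne hqp hlq)
  rw [globalSym_eq_of_subset {2, l, q} (by
      simp [Finset.insert_subset_iff, hl, hq, Nat.two_mem_primesBelow hN]) (by simp)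
    fun p hp hps => ⟨hp.not_intCast_dvd_of_ne hlp (by grind),
      hp.not_intCast_dvd_of_ne hqp (by grind)⟩,
    realSym_natCast_left, one_mul, Finset.prod_insert (by grind), Finset.prod_pair hlq,
    localSym_comm l, localSym_self_right (hlp.not_intCast_dvd_of_ne hqp hlq),
    localSym_self_right (hqp.not_intCast_dvd_of_ne hlp hlq.symm), localSym_of_not_dvd h2l h2q]
  have hlo := hlp.eq_two_or_odd.resolve_left hl2
  have hqo := hqp.eq_two_or_odd.resolve_left hq2
  rw [unitChar, if_neg hl2] at hJ
  simp only [unitChar, if_neg hl2, if_neg hq2, unitSym, Int.cast_natCast]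
  have h1 : (1 : ℤ) ≠ -1 := by decide
  have hl4 : l % 4 = 1 ∨ l % 4 = 3 := by omega
  have hq4 : q % 4 = 1 ∨ q % 4 = 3 := by omega
  rcases hl4 with hl4 | hl4
  · rw [← jacobiSym.quadratic_reciprocity_one_mod_four hl4 (Nat.odd_iff.2 hqo)] at *
    rcases hJ with hJ | hJ <;> simp [ZMod.χ₄_nat_one_mod_four hl4, hJ, h1]
  rcases hq4 with hq4 | hq4
  · rw [jacobiSym.quadratic_reciprocity_one_mod_four hq4 (Nat.odd_iff.2 hlo)] at *
    rcases hJ with hJ | hJ <;> simp [ZMod.χ₄_nat_one_mod_four hq4, hJ, h1]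
  · rw [jacobiSym.quadratic_reciprocity_three_mod_four hl4 hq4]
    rcases hJ with hJ | hJ <;>
      simp [ZMod.χ₄_nat_three_mod_four hl4, ZMod.χ₄_nat_three_mod_four hq4, hJ]

theorem globalSym_prime_prime {N l q : ℕ} (hN : 2 < N) (hl : l ∈ N.primesBelow)
    (hq : q ∈ N.primesBelow) : globalSym N l q = 1 := by
  obtain rfl | hlq := eq_or_ne l q
  · have hl0 : (l : ℤ) ≠ 0 := Nat.cast_ne_zero.2 (Nat.mem_primesBelow.1 hl).2.ne_zero
    have h1 : globalSym N l (-l) = 1 := by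
      rw [globalSym, realSym_natCast_left, one_mul]
      refine Finset.prod_eq_one fun p hp => ?_
      have : Fact p.Prime := ⟨(Nat.mem_primesBelow.1 hp).2⟩
      exact localSym_neg_self hl0
    rw [← neg_one_mul, globalSym_comm, globalSym_mul_left _ _ (by decide) hl0,
      globalSym_neg_one_prime hN hl, one_mul] at h1
    exact h1
  obtain rfl | hl2 := eq_or_ne l 2
  · exact globalSym_two_prime hN hq hlq.symm
  obtain rfl | hq2 := eq_or_ne q 2
  · rw [globalSym_comm]
    exact globalSym_two_prime hN hl hlq
  exact globalSym_odd_prime_odd_prime hN hl hq hl2 hq2 hlq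

theorem globalSym_eq_one_of_generators {N : ℕ} {b : ℤ} (h1 : globalSym N (-1) b = 1)
    (hp : ∀ p ∈ N.primesBelow, globalSym N p b = 1) {a : ℤ} (ha : a ≠ 0) (haN : a.natAbs < N) :
    globalSym N a b = 1 := by
  have hone : globalSym N 1 b = 1 := by
    have := globalSym_mul_left N b (a := -1) (a' := -1) (by decide) (by decide)
    rwa [h1, mul_one] at this
  have hnat : ∀ n : ℕ, n ≠ 0 → n < N → globalSym N n b = 1 := by
    intro n
    induction n using induction_on_primes with
    | zero => simp
    | one => intro _ _; exact_mod_cast hone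
    | prime_mul q n hq ih =>
      intro h0 hlt
      have hn : n ≠ 0 := right_ne_zero_of_mul h0
      have hnN : n < N := (Nat.le_mul_of_pos_left n hq.pos).trans_lt hlt
      have hqN : q < N := (Nat.le_mul_of_pos_right q (Nat.pos_of_ne_zero hn)).trans_lt hlt
      rw [Nat.cast_mul, globalSym_mul_left _ _ (Nat.cast_ne_zero.2 hq.ne_zero)
        (Nat.cast_ne_zero.2 hn), hp q (Nat.mem_primesBelow.2 ⟨hqN, hq⟩), ih hn hnN, one_mul]
  have habs := hnat a.natAbs (Int.natAbs_ne_zero.2 ha) haN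
  rcases a.natAbs_eq with h | h
  · rwa [h]
  · rw [h, ← neg_one_mul, globalSym_mul_left _ _ (by decide)
      (Nat.cast_ne_zero.2 (Int.natAbs_ne_zero.2 ha)), h1, habs, one_mul]

theorem globalSym_eq_one {N : ℕ} (hN : 2 < N) {a b : ℤ} (ha : a ≠ 0) (hb : b ≠ 0)
    (haN : a.natAbs < N) (hbN : b.natAbs < N) : globalSym N a b = 1 := by
  refine globalSym_eq_one_of_generators ?_ (fun p hp => ?_) ha haN
  · rw [globalSym_comm]
    refine globalSym_eq_one_of_generators (globalSym_neg_one_neg_one hN) (fun q hq => ?_) hb hbN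
    rw [globalSym_comm]
    exact globalSym_neg_one_prime hN hq
  · rw [globalSym_comm]
    exact globalSym_eq_one_of_generators (globalSym_neg_one_prime hN hp)
      (fun q hq => globalSym_prime_prime hN hq hp) hb hbN

theorem HilbertSolvable.ratCast_iff {K : Type*} [Field K] [CharZero K] (a b : ℚ) :
    HilbertSolvable K a b ↔
      HilbertSolvable K ((a.num * a.den : ℤ) : K) ((b.num * b.den : ℤ) : K) := by
  have key : ∀ c : ℚ, (((c.num * c.den : ℤ) : K)) = (c.den : K) ^ 2 * (c : K) := fun c => by
    have h : (c.den : ℚ) * c = c.num := Rat.den_mul_eq_num c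
    have h' : (c.den : K) * c = c.num := by exact_mod_cast congrArg ((↑) : ℚ → K) h
    push_cast
    rw [← h']
    ring
  rw [key, key, sq_mul_left (Nat.cast_ne_zero.2 a.den_ne_zero),
    sq_mul_right (Nat.cast_ne_zero.2 b.den_ne_zero)]

theorem ite_one_neg_one_eq {P : Prop} {_ : Decidable P} {s : ℤ} (hs : s = 1 ∨ s = -1) (h : P ↔ s = 1) :
    (if P then (1 : ℤ) else -1) = s := by
  rcases hs with rfl | rfl <;> simp [h]

theorem Rat.num_mul_den_ne_zero {a : ℚ} (ha : a ≠ 0) : a.num * a.den ≠ 0 :=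
  mul_ne_zero (Rat.num_ne_zero.2 ha) (Int.natCast_ne_zero.2 a.den_ne_zero)

theorem hilbertSymReal_eq {a b : ℚ} (ha : a ≠ 0) (hb : b ≠ 0) :
    hilbertSymReal a b = realSym (a.num * a.den) (b.num * b.den) := by
  refine ite_one_neg_one_eq ?_ ((HilbertSolvable.ratCast_iff a b).trans
    (HilbertSolvable.real_iff (Rat.num_mul_den_ne_zero ha) (Rat.num_mul_den_ne_zero hb)))
  unfold realSym
  split_ifs <;> simp

theorem hilbertSymQp_eq {a b : ℚ} (ha : a ≠ 0) (hb : b ≠ 0) {p : ℕ} (hp : p.Prime) :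
    hilbertSymQp a b p = localSym p (a.num * a.den) (b.num * b.den) := by
  have : Fact p.Prime := ⟨hp⟩
  have hA := Rat.num_mul_den_ne_zero ha
  have hB := Rat.num_mul_den_ne_zero hb
  rw [hilbertSymQp, dif_pos hp]
  exact ite_one_neg_one_eq (localSym_eq_one_or hA hB)
    ((HilbertSolvable.ratCast_iff a b).trans (HilbertSolvable.padic_iff hA hB))

/-- For nonzero rationals `a, b`, the set of places of `ℚ` at which the Hilbert
symbol `(a,b)_v` equals `-1` is finite and even; equivalently, the product of
`(a,b)_v` over all places is `1`. -/
theorem hilbert_product_formula (a b : ℚ) (ha : a ≠ 0) (hb : b ≠ 0) :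
    ∃ S : Finset ℕ,
      (∀ p : ℕ, p ∈ S ↔ p.Prime ∧ hilbertSymQp a b p = -1) ∧
      Even (S.card + if hilbertSymReal a b = -1 then 1 else 0) ∧
      hilbertSymReal a b * ∏ p ∈ S, hilbertSymQp a b p = 1 := by
  have hA := Rat.num_mul_den_ne_zero ha
  have hB := Rat.num_mul_den_ne_zero hb
  have hreal := hilbertSymReal_eq ha hb
  have hloc := fun (p : ℕ) (hp : p.Prime) => hilbertSymQp_eq ha hb hp
  generalize a.num * a.den = A at *
  generalize b.num * b.den = B at *
  set N := A.natAbs + B.natAbs + 3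
  have hglob := globalSym_eq_one (N := N) (by omega) hA hB (by omega) (by omega)
  have hmem : ∀ p : ℕ, p ∈ N.primesBelow.filter (fun p => hilbertSymQp a b p = -1) ↔
      p.Prime ∧ hilbertSymQp a b p = -1 := by
    intro p
    rw [Finset.mem_filter, Nat.mem_primesBelow]
    refine ⟨fun h => ⟨h.1.2, h.2⟩, fun h => ⟨⟨?_, h.1⟩, h.2⟩⟩
    by_contra! hpN
    have : Fact p.Prime := ⟨h.1⟩
    have not_dvd : ∀ C : ℤ, C ≠ 0 → C.natAbs < p → ¬ (p : ℤ) ∣ C := fun C hC hlt hd =>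
      hC (Int.eq_zero_of_dvd_of_natAbs_lt_natAbs hd (by simpa using hlt))
    have := localSym_of_not_dvd_of_ne_two (p := p) (by omega) (not_dvd A hA (by omega))
      (not_dvd B hB (by omega))
    rw [← hloc p h.1, h.2] at this
    exact absurd this (by decide)
  have hprod : hilbertSymReal a b *
      ∏ p ∈ N.primesBelow.filter (fun p => hilbertSymQp a b p = -1), hilbertSymQp a b p = 1 := by
    refine Eq.trans ?_ hglob
    rw [globalSym, hreal, Finset.prod_congr rfl fun p hp =>
      hloc p (Nat.mem_primesBelow.1 (Finset.mem_filter.1 hp).1).2]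
    congr 1
    refine Finset.prod_subset (Finset.filter_subset _ _) fun p hp hp' => ?_
    have hpp := (Nat.mem_primesBelow.1 hp).2
    have : Fact p.Prime := ⟨hpp⟩
    refine (localSym_eq_one_or hA hB).resolve_right fun h => hp' ?_
    exact Finset.mem_filter.2 ⟨hp, (hloc p hpp).trans h⟩
  refine ⟨_, hmem, ?_, hprod⟩
  rw [Finset.prod_congr rfl fun p hp => (Finset.mem_filter.1 hp).2, Finset.prod_const] at hprod
  split_ifs with hr
  · rw [hr, ← pow_succ'] at hprod
    exact (neg_one_pow_eq_one_iff_even (by decide)).1 hprod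
  · have hr1 : hilbertSymReal a b = 1 := by
      rw [hilbertSymReal] at hr ⊢
      split_ifs at hr ⊢ <;> simp_all
    rw [hr1, one_mul] at hprod
    exact (neg_one_pow_eq_one_iff_even (by decide)).1 hprod
end

section
/- Let a, b ∈ ℚˣ and let w be a place of ℚ. If the Hilbert symbol (a,b)_v = 1 for all places v ≠ w, then also (a,b)_w = 1. -/
/-- The diagonal ternary quadratic form `A x² + B y² + C z²` has a nontrivial zero over `K`. -/
def TernaryIsotropic (K : Type) [Field K] (A B C : K) : Prop :=
  ∃ x y z : K, ¬(x = 0 ∧ y = 0 ∧ z = 0) ∧ A * x ^ 2 + B * y ^ 2 + C * z ^ 2 = 0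

namespace TernaryIsotropic

section Field

variable {K : Type} [Field K] {A B C : K}

lemma swap (h : TernaryIsotropic K A B C) : TernaryIsotropic K B A C := by
  obtain ⟨x, y, z, h0, h⟩ := h
  exact ⟨y, x, z, by tauto, by linear_combination h⟩

lemma rotate (h : TernaryIsotropic K A B C) : TernaryIsotropic K B C A := by
  obtain ⟨x, y, z, h0, h⟩ := h
  exact ⟨y, z, x, by tauto, by linear_combination h⟩

lemma rotate_iff : TernaryIsotropic K A B C ↔ TernaryIsotropic K B C A :=
  ⟨rotate, fun h => h.rotate.rotate⟩

lemma mul_sq_left_iff {d : K} (hd : d ≠ 0) :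
    TernaryIsotropic K (A * d ^ 2) B C ↔ TernaryIsotropic K A B C := by
  constructor
  · rintro ⟨x, y, z, h0, h⟩
    exact ⟨d * x, y, z, by simpa [hd] using h0, by linear_combination h⟩
  · rintro ⟨x, y, z, h0, h⟩
    refine ⟨x / d, y, z, by simpa [hd] using h0, ?_⟩
    rw [← h]
    field_simp

lemma mul_mul_iff {d : K} (hd : d ≠ 0) :
    TernaryIsotropic K (d * A) (d * B) C ↔ TernaryIsotropic K A B (d * C) := by
  constructor
  · rintro ⟨x, y, z, h0, h⟩
    exact ⟨d * x, d * y, z, by simpa [hd] using h0, by linear_combination d * h⟩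
  · rintro ⟨x, y, z, h0, h⟩
    exact ⟨x, y, d * z, by simpa [hd] using h0, by linear_combination d * h⟩

/-- The conic `a x² + b y² = 1` has a point iff its projective closure has one. -/
lemma exists_eq_one_iff [CharZero K] (hA : A ≠ 0) (hB : B ≠ 0) :
    (∃ x y : K, A * x ^ 2 + B * y ^ 2 = 1) ↔ TernaryIsotropic K A B (-1) := by
  constructor
  · rintro ⟨x, y, h⟩
    exact ⟨x, y, 1, by simp, by linear_combination h⟩
  · rintro ⟨x, y, z, h0, h⟩
    by_cases hz : z = 0
    · subst hz
      have hy : y ≠ 0 := by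
        rintro rfl
        apply h0
        simpa [hA] using h
      have hx : x ≠ 0 := by
        rintro rfl
        apply h0
        simpa [hB] using h
      refine ⟨(1 + 1 / A) / 2, (1 / A - 1) / 2 * (y / x), ?_⟩
      have hB' : B = -A * x ^ 2 / y ^ 2 := by
        field_simp
        linear_combination h
      rw [hB']
      field_simp
      ring
    · refine ⟨x / z, y / z, ?_⟩
      field_simp
      linear_combination h

end Field

lemma real_iff {A B C : ℤ} (hA : A ≠ 0) (hB : B ≠ 0) (hC : C ≠ 0) :
    TernaryIsotropic ℝ A B C ↔ ¬(0 < A ∧ 0 < B ∧ 0 < C) ∧ ¬(A < 0 ∧ B < 0 ∧ C < 0) := by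
  have key : ∀ {U V W : ℝ}, 0 < U → V < 0 → TernaryIsotropic ℝ U V W := by
    intro U V W hU hV
    refine ⟨√(-V), √U, 0, ?_, ?_⟩
    · simp [Real.sqrt_eq_zero', not_le.2 hU]
    · rw [Real.sq_sqrt hU.le, Real.sq_sqrt (by linarith)]
      ring
  constructor
  · rintro ⟨x, y, z, h0, h⟩
    constructor
    · rintro ⟨h1, h2, h3⟩
      have h1' : (0 : ℝ) < A := by exact_mod_cast h1
      have h2' : (0 : ℝ) < B := by exact_mod_cast h2
      have h3' : (0 : ℝ) < C := by exact_mod_cast h3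
      apply h0
      have e1 := mul_nonneg h1'.le (sq_nonneg x)
      have e2 := mul_nonneg h2'.le (sq_nonneg y)
      have e3 := mul_nonneg h3'.le (sq_nonneg z)
      have f1 : A * x ^ 2 = 0 := by linarith
      have f2 : B * y ^ 2 = 0 := by linarith
      have f3 : C * z ^ 2 = 0 := by linarith
      simpa [h1'.ne', h2'.ne', h3'.ne', hA, hB, hC] using And.intro f1 (And.intro f2 f3)
    · rintro ⟨h1, h2, h3⟩
      have h1' : (A : ℝ) < 0 := by exact_mod_cast h1
      have h2' : (B : ℝ) < 0 := by exact_mod_cast h2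
      have h3' : (C : ℝ) < 0 := by exact_mod_cast h3
      apply h0
      have e1 := mul_nonpos_of_nonpos_of_nonneg h1'.le (sq_nonneg x)
      have e2 := mul_nonpos_of_nonpos_of_nonneg h2'.le (sq_nonneg y)
      have e3 := mul_nonpos_of_nonpos_of_nonneg h3'.le (sq_nonneg z)
      have f1 : A * x ^ 2 = 0 := by linarith
      have f2 : B * y ^ 2 = 0 := by linarith
      have f3 : C * z ^ 2 = 0 := by linarith
      simpa [hA, hB, hC] using And.intro f1 (And.intro f2 f3)
  · rintro ⟨h1, h2⟩
    have pos : ∀ {n : ℤ}, 0 < n → (0 : ℝ) < n := fun h => by exact_mod_cast h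
    have neg : ∀ {n : ℤ}, n < 0 → (n : ℝ) < 0 := fun h => by exact_mod_cast h
    rcases lt_or_gt_of_ne hA with a | a <;> rcases lt_or_gt_of_ne hB with b | b
    · rcases lt_or_gt_of_ne hC with c | c
      · tauto
      · exact (key (pos c) (neg a)).rotate
    · exact (key (pos b) (neg a)).swap
    · exact key (pos a) (neg b)
    · rcases lt_or_gt_of_ne hC with c | c
      · exact (key (pos a) (neg c)).swap.rotate
      · tauto

end TernaryIsotropic

section Local

variable {p : ℕ} [hp : Fact p.Prime]

/-- Hensel's lemma for square roots of integers. -/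
lemma Padic.isSquare_intCast_of_pow_dvd {n t : ℤ} (k : ℕ) (h : (p : ℤ) ^ (2 * k + 1) ∣ n - t ^ 2)
    (ht : ¬ (p : ℤ) ^ (k + 1) ∣ 2 * t) : IsSquare (n : ℚ_[p]) := by
  have hp1 : (1 : ℝ) < p := by exact_mod_cast hp.out.one_lt
  have h1 : ‖((t ^ 2 - n : ℤ) : ℤ_[p])‖ ≤ (p : ℝ) ^ (-(2 * k + 1 : ℕ) : ℤ) := by
    rw [PadicInt.norm_int_le_pow_iff_dvd, ← dvd_neg]
    simpa using h
  have h2 : (p : ℝ) ^ (-k : ℤ) ≤ ‖((2 * t : ℤ) : ℤ_[p])‖ := by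
    rw [← not_lt]
    intro hlt
    apply ht
    rw [← PadicInt.norm_int_le_pow_iff_dvd, PadicInt.norm_le_pow_iff_norm_lt_pow_add_one]
    rwa [show (-(k + 1 : ℕ) : ℤ) + 1 = -k by push_cast; ring]
  obtain ⟨z, hz, -⟩ := hensels_lemma (p := p) (R := ℤ_[p])
    (F := Polynomial.X ^ 2 - Polynomial.C (n : ℤ_[p])) (a := (t : ℤ_[p])) (by
      have e1 : (Polynomial.aeval (t : ℤ_[p]))
          (Polynomial.X ^ 2 - Polynomial.C (n : ℤ_[p])) = ((t ^ 2 - n : ℤ) : ℤ_[p]) := by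
        simp
      have e2 : (Polynomial.aeval (t : ℤ_[p])) (Polynomial.derivative
          (Polynomial.X ^ 2 - Polynomial.C (n : ℤ_[p]))) = ((2 * t : ℤ) : ℤ_[p]) := by
        simp [one_add_one_eq_two]
      rw [e1, e2]
      refine h1.trans_lt (lt_of_lt_of_le ?_ (pow_le_pow_left₀ (by positivity) h2 2))
      rw [← zpow_natCast, ← zpow_mul]
      apply zpow_lt_zpow_right₀ hp1
      push_cast
      linarith)
  refine ⟨(z : ℚ_[p]), ?_⟩
  have hz' : z ^ 2 - (n : ℤ_[p]) = 0 := by simpa using hz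
  have := congrArg (fun u : ℤ_[p] => (u : ℚ_[p])) hz'
  push_cast at this
  linear_combination -this

namespace TernaryIsotropic

/-- A nontrivial `p`-adic zero gives primitive integral zeros modulo every power of `p`. -/
lemma exists_int_pow_dvd {A B C : ℤ} (h : TernaryIsotropic ℚ_[p] A B C) {n : ℕ} (hn : n ≠ 0) :
    ∃ x y z : ℤ, (p : ℤ) ^ n ∣ A * x ^ 2 + B * y ^ 2 + C * z ^ 2 ∧
      ¬((p : ℤ) ∣ x ∧ (p : ℤ) ∣ y ∧ (p : ℤ) ∣ z) := by
  obtain ⟨x, y, z, h0, h⟩ := h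
  obtain ⟨m, hm, hx, hy, hz⟩ : ∃ m, (m = x ∨ m = y ∨ m = z) ∧ ‖x‖ ≤ ‖m‖ ∧ ‖y‖ ≤ ‖m‖ ∧ ‖z‖ ≤ ‖m‖ := by
    rcases le_total ‖x‖ ‖y‖ with h1 | h1 <;> rcases le_total ‖y‖ ‖z‖ with h2 | h2 <;>
      rcases le_total ‖x‖ ‖z‖ with h3 | h3
    · exact ⟨z, by tauto, h3, h2, le_rfl⟩
    · exact ⟨z, by tauto, h1.trans h2, h2, le_rfl⟩
    · exact ⟨y, by tauto, h1, le_rfl, h2⟩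
    · exact ⟨y, by tauto, h1, le_rfl, h2⟩
    · exact ⟨z, by tauto, h3, h2, le_rfl⟩
    · exact ⟨x, by tauto, le_rfl, h1, h3⟩
    · exact ⟨x, by tauto, le_rfl, h1, h2.trans h1⟩
    · exact ⟨x, by tauto, le_rfl, h1, h3⟩
  have hm0 : m ≠ 0 := by
    rintro rfl
    simp at hx hy hz
    tauto
  have hdiv : ∀ u : ℚ_[p], ‖u‖ ≤ ‖m‖ → ‖u / m‖ ≤ 1 := fun u hu => by
    rw [norm_div]
    exact div_le_one_of_le₀ hu (norm_nonneg _)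
  let X : ℤ_[p] := ⟨x / m, hdiv x hx⟩
  let Y : ℤ_[p] := ⟨y / m, hdiv y hy⟩
  let Z : ℤ_[p] := ⟨z / m, hdiv z hz⟩
  have hXYZ : (A : ℤ_[p]) * X ^ 2 + B * Y ^ 2 + C * Z ^ 2 = 0 := by
    apply Subtype.ext
    push_cast
    simp only [X, Y, Z]
    field_simp
    rw [h, mul_zero]
  have hone : X = 1 ∨ Y = 1 ∨ Z = 1 := by
    rcases hm with rfl | rfl | rfl
    · left; apply Subtype.ext; simp [X, hm0]
    · right; left; apply Subtype.ext; simp [Y, hm0]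
    · right; right; apply Subtype.ext; simp [Z, hm0]
  have happ : ∀ u : ℤ_[p], ∃ v : ℤ, (v : ZMod (p ^ n)) = PadicInt.toZModPow n u :=
    fun u => ZMod.intCast_surjective _
  obtain ⟨x', hx'⟩ := happ X
  obtain ⟨y', hy'⟩ := happ Y
  obtain ⟨z', hz'⟩ := happ Z
  refine ⟨x', y', z', ?_, ?_⟩
  · have := congrArg (PadicInt.toZModPow n) hXYZ
    simp only [map_add, map_mul, map_pow, map_intCast, map_zero, ← hx', ← hy', ← hz'] at this
    rw [← Nat.cast_pow, ← ZMod.intCast_zmod_eq_zero_iff_dvd]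
    exact_mod_cast this
  · have hunit : ∀ {v : ℤ} {u : ℤ_[p]}, (v : ZMod (p ^ n)) = PadicInt.toZModPow n u → u = 1 →
        ¬ (p : ℤ) ∣ v := by
      rintro v u hv rfl hdvd
      have h1 : ((v - 1 : ℤ) : ZMod (p ^ n)) = 0 := by
        push_cast
        rw [hv, map_one, sub_self]
      rw [ZMod.intCast_zmod_eq_zero_iff_dvd, Nat.cast_pow] at h1
      have h2 := (dvd_sub_right hdvd).1 ((dvd_pow_self _ hn).trans h1)
      exact hp.out.one_lt.ne' (by exact_mod_cast Int.eq_one_of_dvd_one (by positivity) h2)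
    rintro ⟨h1, h2, h3⟩
    rcases hone with h | h | h
    · exact hunit hx' h h1
    · exact hunit hy' h h2
    · exact hunit hz' h h3

/-- If `A x² + B y² + C z²` is sufficiently divisible by `p` and `A x` is a unit, the zero lifts. -/
lemma of_pow_dvd {A B C x y z : ℤ} (k : ℕ) (hA : A ≠ 0)
    (h : (p : ℤ) ^ (2 * k + 1) ∣ A * x ^ 2 + B * y ^ 2 + C * z ^ 2)
    (hx : ¬ (p : ℤ) ^ (k + 1) ∣ 2 * (A * x)) : TernaryIsotropic ℚ_[p] A B C := by
  wlog hyz : ¬(y = 0 ∧ z = 0) generalizing y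
  · obtain ⟨rfl, rfl⟩ := not_not.1 hyz
    refine this (y := (p : ℤ) ^ (2 * k + 1)) ?_ fun h => pow_ne_zero _ (by simp [hp.out.ne_zero]) h.1
    have h' := h.add (dvd_mul_left ((p : ℤ) ^ (2 * k + 1)) (B * (p : ℤ) ^ (2 * k + 1)))
    rwa [show A * x ^ 2 + B * 0 ^ 2 + C * 0 ^ 2 + B * (p : ℤ) ^ (2 * k + 1) * (p : ℤ) ^ (2 * k + 1) =
      A * x ^ 2 + B * ((p : ℤ) ^ (2 * k + 1)) ^ 2 + C * 0 ^ 2 by ring] at h'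
  obtain ⟨s, hs⟩ := Padic.isSquare_intCast_of_pow_dvd (p := p)
    (n := -A * (B * y ^ 2 + C * z ^ 2)) (t := A * x) k (by
      rw [show -A * (B * y ^ 2 + C * z ^ 2) - (A * x) ^ 2 =
        -A * (A * x ^ 2 + B * y ^ 2 + C * z ^ 2) by ring]
      exact h.mul_left _) hx
  have hA' : (A : ℚ_[p]) ≠ 0 := by exact_mod_cast hA
  refine ⟨s / A, y, z, ?_, ?_⟩
  · rintro ⟨-, h2, h3⟩
    exact hyz ⟨by exact_mod_cast h2, by exact_mod_cast h3⟩
  · push_cast at hs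
    field_simp
    linear_combination -hs

lemma of_odd_prime {A B C : ℤ} (hp2 : p ≠ 2) (hA : ¬ (p : ℤ) ∣ A) {x y z : ℤ} (hx : ¬ (p : ℤ) ∣ x)
    (h : (p : ℤ) ∣ A * x ^ 2 + B * y ^ 2 + C * z ^ 2) : TernaryIsotropic ℚ_[p] A B C := by
  have hpp : Prime (p : ℤ) := Nat.prime_iff_prime_int.1 hp.out
  refine of_pow_dvd (x := x) (y := y) (z := z) 0 (by rintro rfl; simp at hA) (by simpa using h) ?_
  rw [zero_add, pow_one, hpp.dvd_mul, hpp.dvd_mul]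
  rintro (h2 | h | h)
  · have h2' : p ∣ 2 := by exact_mod_cast h2
    exact hp2 ((Nat.prime_dvd_prime_iff_eq hp.out Nat.prime_two).1 h2')
  · exact hA h
  · exact hx h

lemma of_not_dvd {A B C : ℤ} (hp2 : p ≠ 2) (hA : ¬ (p : ℤ) ∣ A) (hB : ¬ (p : ℤ) ∣ B)
    (hC : ¬ (p : ℤ) ∣ C) : TernaryIsotropic ℚ_[p] A B C := by
  have hpp : Prime (p : ℤ) := Nat.prime_iff_prime_int.1 hp.out
  have hA' : (A : ZMod p) ≠ 0 := by rwa [Ne, ZMod.intCast_zmod_eq_zero_iff_dvd]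
  have hB' : (B : ZMod p) ≠ 0 := by rwa [Ne, ZMod.intCast_zmod_eq_zero_iff_dvd]
  obtain ⟨x, y, hxy⟩ := FiniteField.exists_root_sum_quadratic (R := ZMod p)
    (f := Polynomial.C (A : ZMod p) * Polynomial.X ^ 2 + Polynomial.C 0 * Polynomial.X
      + Polynomial.C (C : ZMod p))
    (g := Polynomial.C (B : ZMod p) * Polynomial.X ^ 2 + Polynomial.C 0 * Polynomial.X
      + Polynomial.C 0)
    (Polynomial.degree_quadratic hA') (Polynomial.degree_quadratic hB')
    (by rw [ZMod.card]; exact hp.out.eq_two_or_odd.resolve_left hp2)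
  obtain ⟨x, rfl⟩ := ZMod.intCast_surjective x
  obtain ⟨y, rfl⟩ := ZMod.intCast_surjective y
  have h : (p : ℤ) ∣ A * x ^ 2 + B * y ^ 2 + C * 1 ^ 2 := by
    rw [← ZMod.intCast_zmod_eq_zero_iff_dvd]
    simp at hxy
    push_cast
    linear_combination hxy
  by_cases hx : (p : ℤ) ∣ x
  · by_cases hy : (p : ℤ) ∣ y
    · exfalso
      apply hC
      have h1 : (p : ℤ) ∣ A * x ^ 2 + B * y ^ 2 :=
        dvd_add ((dvd_pow hx two_ne_zero).mul_left _) ((dvd_pow hy two_ne_zero).mul_left _)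
      simpa using (dvd_add_right h1).1 h
    · exact (of_odd_prime hp2 hB hy (by rwa [add_comm (B * _)])).swap
  · exact of_odd_prime hp2 hA hx h

lemma padic_iff_of_dvd {A B C : ℤ} (hA : (p : ℤ) ∣ A) (hA2 : ¬ (p : ℤ) ^ 2 ∣ A)
    (hp2 : p ≠ 2) (hB : ¬ (p : ℤ) ∣ B) (hC : ¬ (p : ℤ) ∣ C) :
    TernaryIsotropic ℚ_[p] A B C ↔ legendreSym p (-(B * C)) = 1 := by
  have hpp : Prime (p : ℤ) := Nat.prime_iff_prime_int.1 hp.out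
  have hB' : (B : ZMod p) ≠ 0 := by rwa [Ne, ZMod.intCast_zmod_eq_zero_iff_dvd]
  have hC' : (C : ZMod p) ≠ 0 := by rwa [Ne, ZMod.intCast_zmod_eq_zero_iff_dvd]
  have hA' : (A : ZMod p) = 0 := by rwa [ZMod.intCast_zmod_eq_zero_iff_dvd]
  rw [legendreSym.eq_one_iff p (by push_cast; simp [hB', hC'])]
  constructor
  · intro h
    obtain ⟨x, y, z, h, h0⟩ := h.exists_int_pow_dvd two_ne_zero
    have hmod : (B : ZMod p) * y ^ 2 + C * z ^ 2 = 0 := by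
      have := (ZMod.intCast_zmod_eq_zero_iff_dvd _ p).2 ((dvd_pow_self _ two_ne_zero).trans h)
      push_cast at this
      simpa [hA'] using this
    have hz : (z : ZMod p) ≠ 0 := by
      intro hz
      have hy : (y : ZMod p) = 0 := by simpa [hz, hB'] using hmod
      rw [ZMod.intCast_zmod_eq_zero_iff_dvd] at hy hz
      refine h0 ⟨?_, hy, hz⟩
      by_contra hx
      apply hA2
      have h1 : (p : ℤ) ^ 2 ∣ B * y ^ 2 + C * z ^ 2 :=
        dvd_add ((pow_dvd_pow_of_dvd hy 2).mul_left _) ((pow_dvd_pow_of_dvd hz 2).mul_left _)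
      rw [add_assoc, dvd_add_left h1] at h
      exact ((hpp.coprime_iff_not_dvd.2 hx).pow).dvd_of_dvd_mul_right h
    refine ⟨B * y / z, ?_⟩
    push_cast
    field_simp
    linear_combination -hmod
  · rintro ⟨t, ht⟩
    obtain ⟨t, rfl⟩ := ZMod.intCast_surjective t
    have ht' : (p : ℤ) ∣ t * t + B * C := by
      rw [← ZMod.intCast_zmod_eq_zero_iff_dvd]
      push_cast at ht ⊢
      linear_combination -ht
    refine (of_odd_prime hp2 hB (x := t) (y := B) (z := 0) ?_ ?_).rotate.rotate
    · intro h
      rw [dvd_add_right (h.mul_left t), hpp.dvd_mul] at ht'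
      tauto
    · rw [show B * t ^ 2 + C * B ^ 2 + A * 0 ^ 2 = B * (t * t + B * C) by ring]
      exact ht'.mul_left B


lemma of_eight_dvd {A B C x y z : ℤ} (hA : Odd A) (hx : Odd x)
    (h : 8 ∣ A * x ^ 2 + B * y ^ 2 + C * z ^ 2) : TernaryIsotropic ℚ_[2] A B C := by
  refine of_pow_dvd (x := x) (y := y) (z := z) 1 (by rintro rfl; simp at hA) (by simpa using h) ?_
  have h2 := hA.mul hx
  rw [Int.odd_iff] at h2
  push_cast
  omega

lemma padic_two_iff_of_odd {A B C : ℤ} (hA : Odd A) (hB : Odd B) (hC : Odd C) :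
    TernaryIsotropic ℚ_[2] A B C ↔ ¬(4 ∣ A - B ∧ 4 ∣ B - C) := by
  constructor
  · rintro h ⟨h1, h2⟩
    obtain ⟨x, y, z, h, h0⟩ := h.exists_int_pow_dvd two_ne_zero
    push_cast at h h0
    have h3 : (4 : ℤ) ∣ A * (x ^ 2 + y ^ 2 + z ^ 2) := by
      have := (h.add (h1.mul_right (y ^ 2))).add ((h1.add h2).mul_right (z ^ 2))
      rwa [show A * x ^ 2 + B * y ^ 2 + C * z ^ 2 + (A - B) * y ^ 2 + (A - B + (B - C)) * z ^ 2 =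
        A * (x ^ 2 + y ^ 2 + z ^ 2) by ring] at this
    have h4 : (4 : ℤ) ∣ x ^ 2 + y ^ 2 + z ^ 2 := by
      refine IsCoprime.dvd_of_dvd_mul_left ?_ h3
      rw [show (4 : ℤ) = 2 ^ 2 by norm_num]
      exact (Int.isCoprime_two_left.2 hA).pow_left
    have sq : ∀ u : ℤ, 2 ∣ u ∧ u ^ 2 % 4 = 0 ∨ u ^ 2 % 4 = 1 := fun u => by
      rcases Int.even_or_odd u with hu | hu
      · obtain ⟨k, rfl⟩ := hu.two_dvd
        left
        exact ⟨hu.two_dvd, by ring_nf; omega⟩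
      · right
        exact Int.sq_mod_four_eq_one_of_odd hu
    have := sq x
    have := sq y
    have := sq z
    omega
  · have key : ∀ {U V W : ℤ}, Odd U → Odd V → Odd W → 4 ∣ U + V →
        TernaryIsotropic ℚ_[2] U V W := by
      intro U V W hU hV hW h
      have : 8 ∣ U + V ∨ 8 ∣ U + V + 4 * W := by
        rw [Int.odd_iff] at hW
        omega
      rcases this with h | h
      · exact of_eight_dvd (x := 1) (y := 1) (z := 0) hU odd_one (by simpa using h)
      · exact of_eight_dvd (x := 1) (y := 1) (z := 2) hU odd_one (by
          rw [show U * 1 ^ 2 + V * 1 ^ 2 + W * 2 ^ 2 = U + V + 4 * W by ring]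
          exact h)
    intro h
    have : 4 ∣ A + B ∨ 4 ∣ B + C ∨ 4 ∣ C + A := by
      rw [Int.odd_iff] at hA hB hC
      omega
    rcases this with h | h | h
    · exact key hA hB hC h
    · exact (key hB hC hA h).rotate.rotate
    · exact (key hC hA hB h).rotate

lemma padic_two_iff_of_even {A B C : ℤ} (hA : Odd A) (hB : Odd B) (hC : Odd C) :
    TernaryIsotropic ℚ_[2] ((2 * A : ℤ) : ℚ_[2]) B C ↔ 8 ∣ B + C ∨ 8 ∣ 2 * A + B + C := by
  constructor
  · intro h
    obtain ⟨x, y, z, h, h0⟩ := h.exists_int_pow_dvd three_ne_zero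
    push_cast at h h0
    have odd_sq : ∀ {u : ℤ}, Odd u → ∃ k, u ^ 2 = 8 * k + 1 := fun {u} hu => by
      have := Int.sq_mod_four_eq_one_of_odd hu
      obtain ⟨k, rfl⟩ := hu
      obtain ⟨m, hm⟩ := Int.even_mul_succ_self k
      exact ⟨m, by linear_combination 4 * hm⟩
    have hpar : Odd y ∧ Odd z := by
      rcases Int.even_or_odd y with hy | hy <;> rcases Int.even_or_odd z with hz | hz
      · exfalso
        obtain ⟨k, rfl⟩ := hy.two_dvd
        obtain ⟨l, rfl⟩ := hz.two_dvd
        rcases Int.even_or_odd x with hx | hx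
        · exact h0 ⟨hx.two_dvd, by simp, by simp⟩
        · have h1 := Int.odd_iff.1 (hA.mul (hx.pow (n := 2)))
          have h2 : 2 * A * x ^ 2 + B * (2 * k) ^ 2 + C * (2 * l) ^ 2 =
            2 * (A * x ^ 2) + 4 * (B * k ^ 2 + C * l ^ 2) := by ring
          omega
      · exfalso
        obtain ⟨k, rfl⟩ := hy.two_dvd
        have h1 := Int.odd_iff.1 (hC.mul (hz.pow (n := 2)))
        have h2 : 2 * A * x ^ 2 + B * (2 * k) ^ 2 + C * z ^ 2 =
            2 * (A * x ^ 2 + 2 * B * k ^ 2) + C * z ^ 2 := by ring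
        omega
      · exfalso
        obtain ⟨k, rfl⟩ := hz.two_dvd
        have h1 := Int.odd_iff.1 (hB.mul (hy.pow (n := 2)))
        have h2 : 2 * A * x ^ 2 + B * y ^ 2 + C * (2 * k) ^ 2 =
            2 * (A * x ^ 2 + 2 * C * k ^ 2) + B * y ^ 2 := by ring
        omega
      · exact ⟨hy, hz⟩
    obtain ⟨k, hk⟩ := odd_sq hpar.1
    obtain ⟨l, hl⟩ := odd_sq hpar.2
    rw [hk, hl] at h
    rcases Int.even_or_odd x with hx | hx
    · obtain ⟨m, rfl⟩ := hx.two_dvd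
      left
      have h2 : 2 * A * (2 * m) ^ 2 + B * (8 * k + 1) + C * (8 * l + 1) =
        8 * (A * m ^ 2 + B * k + C * l) + (B + C) := by ring
      omega
    · obtain ⟨m, hm⟩ := odd_sq hx
      right
      have h2 : 2 * A * x ^ 2 + B * (8 * k + 1) + C * (8 * l + 1) =
        8 * (2 * A * m + B * k + C * l) + (2 * A + B + C) := by
        rw [hm]
        ring
      omega
  · rintro (h | h)
    · exact (of_eight_dvd (x := 1) (y := 1) (z := 0) hB odd_one (by simpa using h)).rotate.rotate
    · refine (of_eight_dvd (x := 1) (y := 1) (z := 1) hB odd_one ?_).rotate.rotate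
      rw [show B * 1 ^ 2 + C * 1 ^ 2 + 2 * A * 1 ^ 2 = 2 * A + B + C by ring]
      exact h

end TernaryIsotropic

end Local

section Reciprocity

open NumberTheorySymbols

lemma jacobiSym.mul_swap {a b : ℕ} (ha : Odd a) (hb : Odd b) (hab : a.Coprime b) :
    J(a | b) * J(b | a) = if a % 4 = 3 ∧ b % 4 = 3 then -1 else 1 := by
  have h := jacobiSym.quadratic_reciprocity_if (Nat.odd_iff.1 ha) (Nat.odd_iff.1 hb)
  have h1 : J(b | a) ^ 2 = 1 := jacobiSym.sq_one (by simpa using hab.symm)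
  rw [← h]
  split_ifs
  · linear_combination -h1
  · linear_combination h1

lemma jacobiSym.neg_one_eq_ite {a : ℕ} (ha : Odd a) : J(-1 | a) = if a % 4 = 1 then 1 else -1 := by
  rw [jacobiSym.at_neg_one ha, ZMod.χ₄_nat_eq_if_mod_four, if_neg (by rw [Nat.odd_iff] at ha; omega)]

lemma jacobiSym.two_eq_ite {a : ℕ} (ha : Odd a) :
    J(2 | a) = if a % 8 = 1 ∨ a % 8 = 7 then 1 else -1 := by
  rw [jacobiSym.at_two ha, ZMod.χ₈_nat_eq_if_mod_eight, if_neg (by rw [Nat.odd_iff] at ha; omega)]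

lemma jacobiSym_triple_product {a b c : ℕ} (ha : Odd a) (hb : Odd b) (hc : Odd c)
    (hab : a.Coprime b) (hbc : b.Coprime c) (hca : c.Coprime a) (r s t e : ℤ) :
    J(-(s * b * (t * c)) | a) * J(-(t * c * (e * (r * a))) | b) * J(-(e * (r * a) * (s * b)) | c) =
      (J(-1 | a) * J(s | a) * J(t | a)) * (J(-1 | b) * J(t | b) * J(r | b) * J(e | b)) *
      (J(-1 | c) * J(r | c) * J(s | c) * J(e | c)) * (if a % 4 = 3 ∧ b % 4 = 3 then -1 else 1) *
      (if b % 4 = 3 ∧ c % 4 = 3 then -1 else 1) * (if c % 4 = 3 ∧ a % 4 = 3 then -1 else 1) := by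
  rw [← jacobiSym.mul_swap ha hb hab, ← jacobiSym.mul_swap hb hc hbc, ← jacobiSym.mul_swap hc ha hca]
  simp only [← neg_one_mul (_ * _ : ℤ), jacobiSym.mul_left]
  ring

lemma jacobiSym_triple_product_odd {a b c : ℕ} (ha : Odd a) (hb : Odd b) (hc : Odd c)
    (hab : a.Coprime b) (hbc : b.Coprime c) (hca : c.Coprime a)
    {r s t : ℤ} (hr : r = 1 ∨ r = -1) (hs : s = 1 ∨ s = -1) (ht : t = 1 ∨ t = -1) :
    J(-(s * b * (t * c)) | a) * J(-(t * c * (r * a)) | b) * J(-(r * a * (s * b)) | c) = 1 ↔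
      (TernaryIsotropic ℚ_[2] ((r * a : ℤ) : ℚ_[2]) ((s * b : ℤ) : ℚ_[2]) ((t * c : ℤ) : ℚ_[2]) ↔
        TernaryIsotropic ℝ ((r * a : ℤ) : ℝ) ((s * b : ℤ) : ℝ) ((t * c : ℤ) : ℝ)) := by
  have h := jacobiSym_triple_product ha hb hc hab hbc hca r s t 1
  simp only [one_mul, jacobiSym.one_left, mul_one] at h
  have hsign : ∀ {u : ℤ}, u = 1 ∨ u = -1 → Odd u := by rintro u (rfl | rfl) <;> decide
  have oa : Odd (a : ℤ) := by exact_mod_cast ha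
  have ob : Odd (b : ℤ) := by exact_mod_cast hb
  have oc : Odd (c : ℤ) := by exact_mod_cast hc
  have or' := (hsign hr).mul oa
  have os := (hsign hs).mul ob
  have ot := (hsign ht).mul oc
  have nz : ∀ {u : ℤ}, Odd u → u ≠ 0 := by rintro _ h rfl; simp at h
  rw [h, TernaryIsotropic.padic_two_iff_of_odd or' os ot,
    TernaryIsotropic.real_iff (nz or') (nz os) (nz ot)]
  have ha4 : a % 4 = 1 ∨ a % 4 = 3 := by rw [Nat.odd_iff] at ha; omega
  have hb4 : b % 4 = 1 ∨ b % 4 = 3 := by rw [Nat.odd_iff] at hb; omega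
  have hc4 : c % 4 = 1 ∨ c % 4 = 3 := by rw [Nat.odd_iff] at hc; omega
  have := ha.pos
  have := hb.pos
  have := hc.pos
  rcases hr with rfl | rfl <;> rcases hs with rfl | rfl <;> rcases ht with rfl | rfl <;>
    simp only [jacobiSym.neg_one_eq_ite, ha, hb, hc, jacobiSym.one_left] <;>
    rcases ha4 with ha4 | ha4 <;> rcases hb4 with hb4 | hb4 <;> rcases hc4 with hc4 | hc4 <;>
    norm_num [ha4, hb4, hc4] <;> omega

set_option maxHeartbeats 2000000 in
lemma jacobiSym_triple_product_even {a b c : ℕ} (ha : Odd a) (hb : Odd b) (hc : Odd c)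
    (hab : a.Coprime b) (hbc : b.Coprime c) (hca : c.Coprime a)
    {r s t : ℤ} (hr : r = 1 ∨ r = -1) (hs : s = 1 ∨ s = -1) (ht : t = 1 ∨ t = -1) :
    J(-(s * b * (t * c)) | a) * J(-(t * c * (2 * (r * a))) | b) *
        J(-(2 * (r * a) * (s * b)) | c) = 1 ↔
      (TernaryIsotropic ℚ_[2] ((2 * (r * a) : ℤ) : ℚ_[2]) ((s * b : ℤ) : ℚ_[2])
          ((t * c : ℤ) : ℚ_[2]) ↔
        TernaryIsotropic ℝ ((2 * (r * a) : ℤ) : ℝ) ((s * b : ℤ) : ℝ) ((t * c : ℤ) : ℝ)) := by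
  have h := jacobiSym_triple_product ha hb hc hab hbc hca r s t 2
  have hsign : ∀ {u : ℤ}, u = 1 ∨ u = -1 → Odd u := by rintro u (rfl | rfl) <;> decide
  have oa : Odd (a : ℤ) := by exact_mod_cast ha
  have ob : Odd (b : ℤ) := by exact_mod_cast hb
  have oc : Odd (c : ℤ) := by exact_mod_cast hc
  have or' := (hsign hr).mul oa
  have os := (hsign hs).mul ob
  have ot := (hsign ht).mul oc
  have nz : ∀ {u : ℤ}, Odd u → u ≠ 0 := by rintro _ h rfl; simp at h
  rw [h, TernaryIsotropic.padic_two_iff_of_even or' os ot,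
    TernaryIsotropic.real_iff (mul_ne_zero two_ne_zero (nz or')) (nz os) (nz ot)]
  have ha4 : a % 4 = 1 ∨ a % 4 = 3 := by rw [Nat.odd_iff] at ha; omega
  have hb8 : (b % 8 = 1 ∨ b % 8 = 3) ∨ b % 8 = 5 ∨ b % 8 = 7 := by rw [Nat.odd_iff] at hb; omega
  have hc8 : (c % 8 = 1 ∨ c % 8 = 3) ∨ c % 8 = 5 ∨ c % 8 = 7 := by rw [Nat.odd_iff] at hc; omega
  have := ha.pos
  have := hb.pos
  have := hc.pos
  have hmod : ∀ n : ℕ, n % 4 = n % 8 % 4 := fun n => by omega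
  rcases hr with rfl | rfl <;> rcases hs with rfl | rfl <;> rcases ht with rfl | rfl <;>
    simp only [jacobiSym.neg_one_eq_ite, jacobiSym.two_eq_ite, ha, hb, hc, jacobiSym.one_left,
      hmod b, hmod c] <;>
    rcases ha4 with ha4 | ha4 <;> rcases hb8 with (hb8 | hb8) | hb8 | hb8 <;>
    rcases hc8 with (hc8 | hc8) | hc8 | hc8 <;>
    norm_num [ha4, hb8, hc8] <;> omega

end Reciprocity

section LastPlace

open NumberTheorySymbols

/-- If the form is isotropic at all places of `ℚ` but one, it is isotropic at the last one. -/
def IsotropicAtLastPlace (A B C : ℤ) : Prop :=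
  (∀ (w : ℕ) [Fact w.Prime], (∀ (p : ℕ) [Fact p.Prime], p ≠ w → TernaryIsotropic ℚ_[p] A B C) →
    TernaryIsotropic ℝ A B C → TernaryIsotropic ℚ_[w] A B C) ∧
  ((∀ (p : ℕ) [Fact p.Prime], TernaryIsotropic ℚ_[p] A B C) → TernaryIsotropic ℝ A B C)

lemma IsotropicAtLastPlace.rotate {A B C : ℤ} (h : IsotropicAtLastPlace A B C) :
    IsotropicAtLastPlace B C A :=
  ⟨fun w _ hp hr => (h.1 w (fun p _ hpw => (hp p hpw).rotate.rotate) hr.rotate.rotate).rotate,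
    fun hp => (h.2 fun p _ => (hp p).rotate.rotate).rotate⟩

lemma jacobiSym_eq_one_of_legendreSym {m : ℤ} {n : ℕ}
    (h : ∀ (p : ℕ) [Fact p.Prime], p ∣ n → legendreSym p m = 1) : J(m | n) = 1 := by
  rw [jacobiSym]
  refine List.prod_eq_one fun x hx => ?_
  obtain ⟨p, hp, rfl⟩ := List.mem_pmap.1 hx
  have : Fact p.Prime := ⟨Nat.prime_of_mem_primeFactorsList hp⟩
  exact h p (Nat.dvd_of_mem_primeFactorsList hp)

lemma jacobiSym_eq_legendreSym {m : ℤ} {n w : ℕ} [hw : Fact w.Prime] (hn : Squarefree n)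
    (hwn : w ∣ n) (h : ∀ (p : ℕ) [Fact p.Prime], p ∣ n → p ≠ w → legendreSym p m = 1) :
    J(m | n) = legendreSym w m := by
  obtain ⟨k, rfl⟩ := hwn
  have hk : J(m | k) = 1 := jacobiSym_eq_one_of_legendreSym fun p _ hpk => by
    refine h p (hpk.mul_left w) ?_
    rintro rfl
    exact hw.out.not_isUnit (hn p (mul_dvd_mul_left p hpk))
  rw [jacobiSym.mul_right' m hw.out.ne_zero (right_ne_zero_of_mul hn.ne_zero), hk, mul_one,
    jacobiSym.legendreSym.to_jacobiSym]

lemma isotropicAtLastPlace_of_jacobiSym {A B C : ℤ} {a b c : ℕ} (hABC : Squarefree (A * B * C))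
    (hA : ∀ p : ℕ, p.Prime → (p ∣ a ↔ p ≠ 2 ∧ (p : ℤ) ∣ A))
    (hB : ∀ p : ℕ, p.Prime → (p ∣ b ↔ p ≠ 2 ∧ (p : ℤ) ∣ B))
    (hC : ∀ p : ℕ, p.Prime → (p ∣ c ↔ p ≠ 2 ∧ (p : ℤ) ∣ C))
    (ha : Squarefree a) (hb : Squarefree b) (hc : Squarefree c)
    (h : J(-(B * C) | a) * J(-(C * A) | b) * J(-(A * B) | c) = 1 ↔
      (TernaryIsotropic ℚ_[2] A B C ↔ TernaryIsotropic ℝ A B C)) :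
    IsotropicAtLastPlace A B C := by
  have hloc : ∀ {U V W : ℤ} {u : ℕ}, Squarefree (U * V * W) →
      (∀ p : ℕ, p.Prime → (p ∣ u ↔ p ≠ 2 ∧ (p : ℤ) ∣ U)) → ∀ (p : ℕ) [Fact p.Prime], p ∣ u →
      (TernaryIsotropic ℚ_[p] U V W ↔ legendreSym p (-(V * W)) = 1) := by
    intro U V W u hUVW hU p hp hpu
    obtain ⟨hp2, hpU⟩ := (hU p hp.out).1 hpu
    have hpp : Prime (p : ℤ) := Nat.prime_iff_prime_int.1 hp.out
    refine TernaryIsotropic.padic_iff_of_dvd hpU ?_ hp2 ?_ ?_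
    · intro h
      exact hpp.not_isUnit (hUVW p ((by rwa [← sq] : (p : ℤ) * p ∣ U).mul_right V |>.mul_right W))
    · intro h
      exact hpp.not_isUnit (hUVW p ((mul_dvd_mul hpU h).mul_right W))
    · intro h
      exact hpp.not_isUnit (hUVW p (mul_dvd_mul (hpU.mul_right V) h))
  have locA := hloc hABC hA
  have locB : ∀ (p : ℕ) [Fact p.Prime], p ∣ b →
      (TernaryIsotropic ℚ_[p] A B C ↔ legendreSym p (-(C * A)) = 1) := fun p _ hpb => by
    rw [TernaryIsotropic.rotate_iff]
    exact hloc (by rwa [show B * C * A = A * B * C by ring]) hB p hpb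
  have locC : ∀ (p : ℕ) [Fact p.Prime], p ∣ c →
      (TernaryIsotropic ℚ_[p] A B C ↔ legendreSym p (-(A * B)) = 1) := fun p _ hpc => by
    rw [TernaryIsotropic.rotate_iff, TernaryIsotropic.rotate_iff]
    exact hloc (by rwa [show C * A * B = A * B * C by ring]) hC p hpc
  have two_not_dvd : ∀ {U : ℤ} {u : ℕ}, (∀ p : ℕ, p.Prime → (p ∣ u ↔ p ≠ 2 ∧ (p : ℤ) ∣ U)) →
      ∀ {p : ℕ}, p.Prime → p ∣ u → p ≠ 2 := fun hU p hp hpu => ((hU p hp).1 hpu).1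
  have one_of : ∀ {m : ℤ} {n : ℕ} (w : ℕ) [Fact w.Prime], (∀ (p : ℕ) [Fact p.Prime], p ∣ n →
        (TernaryIsotropic ℚ_[p] A B C ↔ legendreSym p m = 1)) →
      (∀ (p : ℕ) [Fact p.Prime], p ≠ w → TernaryIsotropic ℚ_[p] A B C) → ¬ w ∣ n →
      J(m | n) = 1 := fun w _ loc hp hwn => jacobiSym_eq_one_of_legendreSym fun p _ hpn =>
    (loc p hpn).1 (hp p (by rintro rfl; exact hwn hpn))
  have leg_of : ∀ {m : ℤ} {n : ℕ} (w : ℕ) [Fact w.Prime], Squarefree n →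
      (∀ (p : ℕ) [Fact p.Prime], p ∣ n →
        (TernaryIsotropic ℚ_[p] A B C ↔ legendreSym p m = 1)) →
      (∀ (p : ℕ) [Fact p.Prime], p ≠ w → TernaryIsotropic ℚ_[p] A B C) → w ∣ n →
      J(m | n) = 1 → TernaryIsotropic ℚ_[w] A B C := fun w _ hn loc hp hwn hJ => by
    rw [loc w hwn, ← hJ, jacobiSym_eq_legendreSym hn hwn]
    exact fun p _ hpn hpw => (loc p hpn).1 (hp p hpw)
  have h2a : ¬ 2 ∣ a := fun h => two_not_dvd hA Nat.prime_two h rfl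
  have h2b : ¬ 2 ∣ b := fun h => two_not_dvd hB Nat.prime_two h rfl
  have h2c : ¬ 2 ∣ c := fun h => two_not_dvd hC Nat.prime_two h rfl
  have h2iff : (∀ (p : ℕ) [Fact p.Prime], p ≠ 2 → TernaryIsotropic ℚ_[p] A B C) →
      (TernaryIsotropic ℚ_[2] A B C ↔ TernaryIsotropic ℝ A B C) := fun hp => by
    rw [← h, one_of 2 locA hp h2a, one_of 2 locB hp h2b, one_of 2 locC hp h2c]
    norm_num
  refine ⟨fun w hw hp hr => ?_, fun hp => (h2iff fun p _ _ => hp p).1 (hp 2)⟩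
  by_cases hw2 : w = 2
  · subst hw2
    exact (h2iff hp).2 hr
  have hprod := h.2 (iff_of_true (hp 2 (Ne.symm hw2)) hr)
  have hwp : Prime (w : ℤ) := Nat.prime_iff_prime_int.1 hw.out
  have cop : ∀ {U V W : ℤ}, Squarefree (U * V * W) → (w : ℤ) ∣ U → ¬ (w : ℤ) ∣ V ∧ ¬ (w : ℤ) ∣ W :=
    fun hUVW hU => ⟨fun hV => hwp.not_isUnit (hUVW w ((mul_dvd_mul hU hV).mul_right _)),
      fun hW => hwp.not_isUnit (hUVW w (mul_dvd_mul (hU.mul_right _) hW))⟩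
  by_cases hwA : (w : ℤ) ∣ A
  · obtain ⟨hwB, hwC⟩ := cop hABC hwA
    rw [one_of w locB hp (by simp [hB w hw.out, hwB]), one_of w locC hp (by simp [hC w hw.out, hwC]),
      mul_one, mul_one] at hprod
    exact leg_of w ha locA hp (by simp [hA w hw.out, hwA, hw2]) hprod
  by_cases hwB : (w : ℤ) ∣ B
  · have hwC := (cop (by rwa [show B * C * A = A * B * C by ring]) hwB).1
    rw [one_of w locA hp (by simp [hA w hw.out, hwA]), one_of w locC hp (by simp [hC w hw.out, hwC]),
      mul_one, one_mul] at hprod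
    exact leg_of w hb locB hp (by simp [hB w hw.out, hwB, hw2]) hprod
  by_cases hwC : (w : ℤ) ∣ C
  · rw [one_of w locA hp (by simp [hA w hw.out, hwA]), one_of w locB hp (by simp [hB w hw.out, hwB]),
      one_mul, one_mul] at hprod
    exact leg_of w hc locC hp (by simp [hC w hw.out, hwC, hw2]) hprod
  exact TernaryIsotropic.of_not_dvd hw2 hwA hwB hwC

lemma isotropicAtLastPlace_of_squarefree {A B C : ℤ} (h : Squarefree (A * B * C)) :
    IsotropicAtLastPlace A B C := by
  wlog hBC : Odd B ∧ Odd C generalizing A B C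
  · have no2 : ∀ {U V W : ℤ}, Squarefree (U * V * W) → Even U → Odd V ∧ Odd W := by
      intro U V W hU h2
      rw [← Int.not_even_iff_odd, ← Int.not_even_iff_odd]
      have hu : ¬ IsUnit (2 : ℤ) := Int.prime_two.not_isUnit
      exact ⟨fun hV => hu (hU 2 ((mul_dvd_mul h2.two_dvd hV.two_dvd).mul_right _)),
        fun hW => hu (hU 2 (mul_dvd_mul (h2.two_dvd.mul_right _) hW.two_dvd))⟩
    rw [not_and_or, Int.not_odd_iff_even, Int.not_odd_iff_even] at hBC
    rcases hBC with hB | hC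
    · have h' : Squarefree (B * C * A) := by rwa [show B * C * A = A * B * C by ring]
      exact (this h' (no2 h' hB)).rotate.rotate
    · have h' : Squarefree (C * A * B) := by rwa [show C * A * B = A * B * C by ring]
      exact (this h' (no2 h' hC)).rotate
  obtain ⟨hB, hC⟩ := hBC
  have hsign : ∀ {U : ℤ}, U ≠ 0 → U.sign = 1 ∨ U.sign = -1 := fun {U} hU => by
    rcases lt_or_gt_of_ne hU with h | h
    · exact Or.inr (Int.sign_eq_neg_one_of_neg h)
    · exact Or.inl (Int.sign_eq_one_of_pos h)
  have hsqA : Squarefree A := h.of_mul_left.of_mul_left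
  have hsqB : Squarefree B := h.of_mul_left.of_mul_right
  have hsqC : Squarefree C := h.of_mul_right
  have hcop : ∀ {U V : ℤ}, Squarefree (U * V) → U.natAbs.Coprime V.natAbs := fun {U V} hUV => by
    rw [← Int.squarefree_natAbs, Int.natAbs_mul] at hUV
    exact Nat.coprime_of_squarefree_mul hUV
  have dvd_iff : ∀ {U : ℤ}, Odd U → ∀ p : ℕ, p.Prime → (p ∣ U.natAbs ↔ p ≠ 2 ∧ (p : ℤ) ∣ U) := by
    intro U hU p hp
    rw [← Int.natCast_dvd, iff_and_self]
    rintro h rfl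
    rw [Int.odd_iff] at hU
    omega
  have hcBC := hcop (h.squarefree_of_dvd ⟨A, by ring⟩ : Squarefree (B * C))
  rcases Int.even_or_odd A with hA | hA
  · obtain ⟨A, rfl⟩ := hA.two_dvd
    have hA : Odd A := by
      rw [← Int.not_even_iff_odd]
      exact fun hA => Int.prime_two.not_isUnit (hsqA 2 (mul_dvd_mul_left 2 hA.two_dvd))
    have hsqA' : Squarefree A := hsqA.of_mul_right
    have hcAB := hcop (h.squarefree_of_dvd ⟨2 * C, by ring⟩ : Squarefree (A * B))
    have hcCA := hcop (h.squarefree_of_dvd ⟨2 * B, by ring⟩ : Squarefree (C * A))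
    have key := jacobiSym_triple_product_even (Int.natAbs_odd.2 hA) (Int.natAbs_odd.2 hB)
      (Int.natAbs_odd.2 hC) hcAB hcBC hcCA (hsign hsqA'.ne_zero) (hsign hsqB.ne_zero)
      (hsign hsqC.ne_zero)
    simp only [Int.sign_mul_natAbs] at key
    refine isotropicAtLastPlace_of_jacobiSym h (fun p hp => ?_) (dvd_iff hB) (dvd_iff hC)
      (Int.squarefree_natAbs.2 hsqA') (Int.squarefree_natAbs.2 hsqB)
      (Int.squarefree_natAbs.2 hsqC) key
    rw [dvd_iff hA p hp, (Nat.prime_iff_prime_int.1 hp).dvd_mul]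
    refine and_congr_right fun hp2 => ⟨Or.inr, fun h => h.resolve_left fun h2 => hp2 ?_⟩
    exact (Nat.prime_dvd_prime_iff_eq hp Nat.prime_two).1 (by exact_mod_cast h2)
  · have hcAB := hcop (h.squarefree_of_dvd ⟨C, by ring⟩ : Squarefree (A * B))
    have hcCA := hcop (h.squarefree_of_dvd ⟨B, by ring⟩ : Squarefree (C * A))
    have key := jacobiSym_triple_product_odd (Int.natAbs_odd.2 hA) (Int.natAbs_odd.2 hB)
      (Int.natAbs_odd.2 hC) hcAB hcBC hcCA (hsign hsqA.ne_zero) (hsign hsqB.ne_zero)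
      (hsign hsqC.ne_zero)
    simp only [Int.sign_mul_natAbs] at key
    exact isotropicAtLastPlace_of_jacobiSym h (dvd_iff hA) (dvd_iff hB) (dvd_iff hC)
      (Int.squarefree_natAbs.2 hsqA) (Int.squarefree_natAbs.2 hsqB)
      (Int.squarefree_natAbs.2 hsqC) key

end LastPlace

section Reduction

/-- The form is equivalent, as far as isotropy is concerned, to one whose coefficients are
squarefree and pairwise coprime. -/
def HasSquarefreeModel (A B C : ℤ) : Prop :=
  ∃ A' B' C' : ℤ, Squarefree (A' * B' * C') ∧ ∀ (K : Type) [Field K] [CharZero K],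
    TernaryIsotropic K A B C ↔ TernaryIsotropic K A' B' C'

lemma HasSquarefreeModel.congr {A B C U V W : ℤ} (h : HasSquarefreeModel U V W)
    (hK : ∀ (K : Type) [Field K] [CharZero K],
      TernaryIsotropic K A B C ↔ TernaryIsotropic K U V W) : HasSquarefreeModel A B C := by
  obtain ⟨A', B', C', hsq, h⟩ := h
  exact ⟨A', B', C', hsq, fun K _ _ => (hK K).trans (h K)⟩

lemma HasSquarefreeModel.rotate {A B C : ℤ} (h : HasSquarefreeModel A B C) :
    HasSquarefreeModel B C A :=
  h.congr fun _ _ _ => TernaryIsotropic.rotate_iff.symm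

lemma hasSquarefreeModel_of_dvd {A B C p : ℤ} (hp : Prime p) (h0 : A * B * C ≠ 0)
    (ih : ∀ U V W : ℤ, U * V * W ≠ 0 → (U * V * W).natAbs < (A * B * C).natAbs →
      HasSquarefreeModel U V W)
    (hpA : p ∣ A) (hpABC : p * p ∣ A * B * C) : HasSquarefreeModel A B C := by
  have hlt : ∀ {m n k : ℤ}, m ≠ 0 → m = k * n → ¬ IsUnit k → n ≠ 0 ∧ n.natAbs < m.natAbs := by
    rintro _ n k hm rfl hk
    have hk0 := left_ne_zero_of_mul hm
    have hn0 := right_ne_zero_of_mul hm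
    refine ⟨hn0, ?_⟩
    rw [Int.natAbs_mul]
    have h1 : k.natAbs ≠ 1 := fun h => hk (Int.isUnit_iff_natAbs_eq.2 h)
    have h2 : 1 < k.natAbs := by
      have := Int.natAbs_ne_zero.2 hk0
      omega
    exact lt_mul_of_one_lt_left (Int.natAbs_pos.2 hn0) h2
  obtain ⟨A, rfl⟩ := hpA
  by_cases hpB : p ∣ B
  · obtain ⟨B, rfl⟩ := hpB
    obtain ⟨hn, hl⟩ := hlt (n := A * B * (p * C)) h0 (by ring) hp.not_isUnit
    refine (ih A B (p * C) hn hl).congr fun K _ _ => ?_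
    push_cast
    exact TernaryIsotropic.mul_mul_iff (by exact_mod_cast hp.ne_zero)
  by_cases hpC : p ∣ C
  · obtain ⟨C, rfl⟩ := hpC
    obtain ⟨hn, hl⟩ := hlt (n := C * A * (p * B)) h0 (by ring) hp.not_isUnit
    refine ((ih C A (p * B) hn hl).congr (A := p * C) (B := p * A) (C := B) fun K _ _ => ?_).rotate
    push_cast
    exact TernaryIsotropic.mul_mul_iff (by exact_mod_cast hp.ne_zero)
  · have hpA : p ∣ A := by
      rw [show p * A * B * C = p * (A * B * C) by ring, mul_dvd_mul_iff_left hp.ne_zero,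
        hp.dvd_mul, hp.dvd_mul] at hpABC
      tauto
    obtain ⟨A, rfl⟩ := hpA
    obtain ⟨hn, hl⟩ := hlt (n := A * B * C) (k := p * p) h0 (by ring)
      fun h => hp.not_isUnit (isUnit_of_mul_isUnit_left h)
    refine (ih A B C hn hl).congr fun K _ _ => ?_
    rw [show p * (p * A) = A * p ^ 2 by ring]
    push_cast
    exact TernaryIsotropic.mul_sq_left_iff (by exact_mod_cast hp.ne_zero)

lemma hasSquarefreeModel {A B C : ℤ} (h0 : A * B * C ≠ 0) : HasSquarefreeModel A B C := by
  induction hn : (A * B * C).natAbs using Nat.strong_induction_on generalizing A B C with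
  | _ n ih =>
    subst hn
    by_cases hsq : Squarefree (A * B * C)
    · exact ⟨A, B, C, hsq, fun _ _ _ => Iff.rfl⟩
    rw [← Int.squarefree_natAbs, Nat.squarefree_iff_prime_squarefree] at hsq
    push Not at hsq
    obtain ⟨p, hp, hdvd⟩ := hsq
    have hpp := Nat.prime_iff_prime_int.1 hp
    have hdvd' : (p * p : ℤ) ∣ A * B * C := by
      rw [← Int.natCast_dvd] at hdvd
      exact_mod_cast hdvd
    have ih' : ∀ U V W : ℤ, U * V * W ≠ 0 → (U * V * W).natAbs < (A * B * C).natAbs →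
      HasSquarefreeModel U V W := fun U V W h hl => ih _ hl h rfl
    rcases hpp.dvd_or_dvd ((dvd_mul_right _ _).trans hdvd') with h | hC
    · rcases hpp.dvd_or_dvd h with hA | hB
      · exact hasSquarefreeModel_of_dvd hpp h0 ih' hA hdvd'
      · have e : A * B * C = B * C * A := by ring
        rw [e] at h0 ih' hdvd'
        exact (hasSquarefreeModel_of_dvd hpp h0 ih' hB hdvd').rotate.rotate
    · have e : A * B * C = C * A * B := by ring
      rw [e] at h0 ih' hdvd'
      exact (hasSquarefreeModel_of_dvd hpp h0 ih' hC hdvd').rotate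

lemma exists_squarefree_model_conic {a b : ℚ} (ha : a ≠ 0) (hb : b ≠ 0) :
    ∃ A B C : ℤ, Squarefree (A * B * C) ∧ ∀ (K : Type) [Field K] [CharZero K],
      (∃ x y : K, (a : K) * x ^ 2 + (b : K) * y ^ 2 = 1) ↔ TernaryIsotropic K A B C := by
  obtain ⟨A, B, C, hsq, h⟩ := hasSquarefreeModel (A := a.num * a.den) (B := b.num * b.den)
    (C := -1) (by simp [ha, hb])
  refine ⟨A, B, C, hsq, fun K _ _ => ?_⟩
  rw [← h, TernaryIsotropic.exists_eq_one_iff (by exact_mod_cast ha) (by exact_mod_cast hb)]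
  have hq : ∀ q : ℚ, ((q.num * q.den : ℤ) : K) = q * (q.den : K) ^ 2 := fun q => by
    have : (q.den : K) ≠ 0 := by exact_mod_cast q.den_ne_zero
    rw [Rat.cast_def]
    push_cast
    field_simp
  have hd : ∀ q : ℚ, (q.den : K) ≠ 0 := fun q => by exact_mod_cast q.den_ne_zero
  rw [hq, hq, TernaryIsotropic.mul_sq_left_iff (hd a), TernaryIsotropic.rotate_iff (A := (a : K)),
    TernaryIsotropic.rotate_iff (A := (a : K)), TernaryIsotropic.mul_sq_left_iff (hd b)]
  simp

end Reduction

/-- If the Hilbert symbol `(a,b)_v = 1` for all places `v` different from a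
place `w` of `ℚ`, then also `(a,b)_w = 1`.  The two conjuncts treat the cases
where `w` is a prime and where `w` is the real place `∞`. -/
theorem hilbert_symbol_last_place (a b : ℚ) (ha : a ≠ 0) (hb : b ≠ 0) :
    (∀ w : ℕ, w.Prime →
      (∀ p : ℕ, p.Prime → p ≠ w → hilbertSymQp a b p = 1) →
      hilbertSymReal a b = 1 →
      hilbertSymQp a b w = 1) ∧
    ((∀ p : ℕ, p.Prime → hilbertSymQp a b p = 1) → hilbertSymReal a b = 1) := by
  obtain ⟨A, B, C, hsq, hK⟩ := exists_squarefree_model_conic ha hb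
  obtain ⟨hfin, hinf⟩ := isotropicAtLastPlace_of_squarefree hsq
  have hp : ∀ (p : ℕ) [hp : Fact p.Prime],
      hilbertSymQp a b p = 1 ↔ TernaryIsotropic ℚ_[p] A B C := fun p hp => by
    rw [← hK ℚ_[p], hilbertSymQp, dif_pos hp.out]
    simp
  have hr : hilbertSymReal a b = 1 ↔ TernaryIsotropic ℝ A B C := by
    rw [← hK ℝ, hilbertSymReal]
    simp
  rw [hr]
  refine ⟨fun w hw h hreal => ?_, fun h => hinf fun p hpp => (hp p).1 (h p hpp.out)⟩
  have : Fact w.Prime := ⟨hw⟩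
  exact (hp w).2 (hfin w (fun p hpp hpw => (hp p).1 (h p hpp.out hpw)) hreal)
end
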